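/- arXiv:1605.04322 — 3 statements merged into one kernel-verified Lean document; each statement's English description precedes it below -/
import Mathlib

section
/- Let p, m be positive natural numbers, let B be a real symmetric positive definite p × p matrix and C a real symmetric positive definite m × m matrix. Then the function A ↦ exp(−tr(B · A · C⁻¹ · Aᵀ)) is integrable over the space of real p × m matrices A, and ∫ exp(−tr(B A C⁻¹ Aᵀ)) dA = π^{pm/2} · (det C)^{p/2} · (det B)^{−m/2}. -/
open Matrix MeasureTheory

open scoped MatrixOrder in
/-- A real positive definite matrix factors as `Sᵀ * S`. -/
theorem Matrix.PosDef.exists_eq_transpose_mul_self {n : Type*} [Fintype n] [DecidableEq n]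
    {B : Matrix n n ℝ} (hB : B.PosDef) : ∃ S : Matrix n n ℝ, B = Sᵀ * S := by
  obtain ⟨S, hS⟩ := CStarAlgebra.nonneg_iff_eq_star_mul_self.mp hB.posSemidef.nonneg
  exact ⟨S, by rw [hS, star_eq_conjTranspose, conjTranspose_eq_transpose_of_trivial]⟩

section LinearChangeOfVariables

variable {E : Type*} [NormedAddCommGroup E] [NormedSpace ℝ E] [MeasurableSpace E] [BorelSpace E]
  [FiniteDimensional ℝ E] (μ : Measure E) [μ.IsAddHaarMeasure]

theorem LinearMap.measurableEmbedding_of_det_ne_zero {f : E →ₗ[ℝ] E}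
    (hf : LinearMap.det f ≠ 0) : MeasurableEmbedding f :=
  (f.equivOfDetNeZero hf).toContinuousLinearEquiv.toHomeomorph.measurableEmbedding

variable {F : Type*} [NormedAddCommGroup F]

theorem MeasureTheory.Integrable.comp_linearMap {μ : Measure E} [μ.IsAddHaarMeasure]
    {f : E →ₗ[ℝ] E} (hf : LinearMap.det f ≠ 0) {g : E → F} (hg : Integrable g μ) :
    Integrable (fun x => g (f x)) μ := by
  refine (f.measurableEmbedding_of_det_ne_zero hf).integrable_map_iff.mp ?_
  rw [Measure.map_linearMap_addHaar_eq_smul_addHaar μ hf]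
  exact hg.smul_measure ENNReal.ofReal_ne_top

theorem MeasureTheory.integral_comp_linearMap [NormedSpace ℝ F] {f : E →ₗ[ℝ] E}
    (hf : LinearMap.det f ≠ 0) (g : E → F) :
    ∫ x, g (f x) ∂μ = |(LinearMap.det f)⁻¹| • ∫ x, g x ∂μ := by
  rw [← (f.measurableEmbedding_of_det_ne_zero hf).integral_map,
    Measure.map_linearMap_addHaar_eq_smul_addHaar μ hf, integral_smul_measure,
    ENNReal.toReal_ofReal (abs_nonneg _)]

end LinearChangeOfVariables

section TwoSidedMultiplication

variable {m n R : Type*} [Fintype m] [Fintype n] [CommRing R]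

/-- The linear map `A ↦ S * A * T` on the space of matrices, seen as functions of two indices. -/
def Matrix.mulLeftRight (S : Matrix m m R) (T : Matrix n n R) : (m → n → R) →ₗ[R] (m → n → R) where
  toFun A := of.symm (S * of A * T)
  map_add' A A' := by rw [← of_add_of, Matrix.mul_add, Matrix.add_mul]; rfl
  map_smul' c A := by
    rw [← smul_of, Matrix.mul_smul, Matrix.smul_mul]; rfl

theorem Matrix.mulLeftRight_apply (S : Matrix m m R) (T : Matrix n n R) (A : m → n → R) (i : m)
    (j : n) : mulLeftRight S T A i j = (S * of A * T) i j := rfl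

open scoped Kronecker in
theorem Matrix.det_mulLeftRight [DecidableEq m] [DecidableEq n] (S : Matrix m m R)
    (T : Matrix n n R) : LinearMap.det (mulLeftRight S T) =
      S.det ^ Fintype.card n * T.det ^ Fintype.card m := by
  let e : (m → n → R) ≃ₗ[R] (n × m → R) :=
    (LinearEquiv.curry R R m n).symm ≪≫ₗ LinearEquiv.funCongrLeft R R (Equiv.prodComm n m)
  have h : (e : _ →ₗ[R] _) ∘ₗ mulLeftRight S T ∘ₗ (e.symm : _ →ₗ[R] _) = (Tᵀ ⊗ₖ S).toLin' := by
    refine LinearMap.ext fun v => ?_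
    obtain ⟨A, rfl⟩ := e.surjective v
    have := kronecker_mulVec_vec S (of A) Tᵀ
    rw [transpose_transpose] at this
    simp only [LinearMap.comp_apply, LinearEquiv.coe_coe, LinearEquiv.symm_apply_apply,
      toLin'_apply]
    exact this.symm
  rw [← LinearMap.det_conj _ e, h, LinearMap.det_toLin', det_kronecker, det_transpose, mul_comm]

end TwoSidedMultiplication

section StandardGaussian

variable {m n : Type*} [Fintype m] [Fintype n]

theorem integrable_exp_neg_sum_sq :
    Integrable fun A : m → n → ℝ => Real.exp (-∑ i, ∑ j, A i j ^ 2) := by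
  simp only [← Finset.sum_neg_distrib, Real.exp_sum]
  have h : Integrable fun x : ℝ => Real.exp (-x ^ 2) := by
    simpa using integrable_exp_neg_mul_sq one_pos
  have hrow : Integrable fun a : n → ℝ => ∏ j, Real.exp (-a j ^ 2) :=
    Integrable.fintype_prod (f := fun _ x => Real.exp (-x ^ 2)) fun _ => h
  exact Integrable.fintype_prod (f := fun (_ : m) (a : n → ℝ) => ∏ j, Real.exp (-a j ^ 2))
    fun _ => hrow

theorem integral_exp_neg_sum_sq :
    ∫ A : m → n → ℝ, Real.exp (-∑ i, ∑ j, A i j ^ 2) =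
      (√Real.pi ^ Fintype.card n) ^ Fintype.card m := by
  simp only [← Finset.sum_neg_distrib, Real.exp_sum]
  rw [integral_fintype_prod_volume_eq_pow fun a : n → ℝ => ∏ j, Real.exp (-a j ^ 2),
    integral_fintype_prod_volume_eq_pow fun x : ℝ => Real.exp (-x ^ 2)]
  have := integral_gaussian 1
  simp only [neg_mul, one_mul, div_one] at this
  rw [this]

end StandardGaussian

theorem Matrix.trace_transpose_mul_self_mul_mul {m n R : Type*} [Fintype m] [Fintype n]
    [CommRing R] (S : Matrix m m R) (T : Matrix n n R) (A : Matrix m n R) :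
    (Sᵀ * S * A * (Tᵀ * T) * Aᵀ).trace = ∑ i, ∑ j, (S * A * Tᵀ) i j ^ 2 := by
  have h : (Sᵀ * S * A * (Tᵀ * T) * Aᵀ).trace = ((S * A * Tᵀ) * (S * A * Tᵀ)ᵀ).trace := by
    rw [transpose_mul, transpose_mul, transpose_transpose, Matrix.mul_assoc, Matrix.mul_assoc,
      Matrix.mul_assoc, trace_mul_comm]
    simp only [Matrix.mul_assoc]
  rw [h]
  simp only [trace, diag_apply, mul_apply (M := S * A * Tᵀ), transpose_apply, sq]

/-- Matrix Gaussian integral.  Let `p, m` be positive, `B` a real symmetric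
positive definite `p × p` matrix, `C` a real symmetric positive definite `m × m` matrix.
Then `A ↦ exp(−tr(B·A·C⁻¹·Aᵀ))` is integrable over the real `p × m` matrices and
`∫ exp(−tr(B A C⁻¹ Aᵀ)) dA = π^(pm/2) · (det C)^(p/2) · (det B)^(−m/2)`. -/
theorem gaussian_matrix_integral (p m : ℕ) (hp : 0 < p) (hm : 0 < m)
    (B : Matrix (Fin p) (Fin p) ℝ) (hB : B.PosDef) (hBsymm : B.IsSymm)
    (C : Matrix (Fin m) (Fin m) ℝ) (hC : C.PosDef) (hCsymm : C.IsSymm) :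
    Integrable (fun A : Fin p → Fin m → ℝ =>
      Real.exp (-((B * Matrix.of A * C⁻¹ * (Matrix.of A)ᵀ).trace))) ∧
    ∫ A : Fin p → Fin m → ℝ,
        Real.exp (-((B * Matrix.of A * C⁻¹ * (Matrix.of A)ᵀ).trace)) =
      Real.pi ^ (((p : ℝ) * m) / 2) * C.det ^ ((p : ℝ) / 2) * B.det ^ (-(m : ℝ) / 2) := by
  obtain ⟨S, hS⟩ := hB.exists_eq_transpose_mul_self
  obtain ⟨T, hT⟩ := hC.inv.exists_eq_transpose_mul_self
  have hBdet : S.det ^ 2 = B.det := by rw [hS, det_mul, det_transpose, sq]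
  have hCdet : T.det ^ 2 = C.det⁻¹ := by
    rw [← Ring.inverse_eq_inv', ← det_nonsing_inv, hT, det_mul, det_transpose, sq]
  have hSabs : |S.det| = B.det ^ (1 / 2 : ℝ) := by
    rw [← Real.sqrt_eq_rpow, ← hBdet, Real.sqrt_sq_eq_abs]
  have hTabs : |T.det| = C.det⁻¹ ^ (1 / 2 : ℝ) := by
    rw [← Real.sqrt_eq_rpow, ← hCdet, Real.sqrt_sq_eq_abs]
  have hBpos := hB.det_pos
  have hCpos := hC.det_pos
  have hSne : S.det ≠ 0 := fun h => by simp [h] at hBdet; exact hBpos.ne hBdet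
  have hTne : T.det ≠ 0 := fun h => by simp [h] at hCdet; exact hCpos.ne hCdet
  have hdet := det_mulLeftRight S Tᵀ
  simp only [det_transpose, Fintype.card_fin] at hdet
  have hne : LinearMap.det (mulLeftRight S Tᵀ) ≠ 0 := by rw [hdet]; positivity
  have hfun (A : Fin p → Fin m → ℝ) : (B * of A * C⁻¹ * (of A)ᵀ).trace =
      ∑ i, ∑ j, mulLeftRight S Tᵀ A i j ^ 2 := by
    simp only [mulLeftRight_apply, ← trace_transpose_mul_self_mul_mul, ← hS, ← hT]
  simp only [hfun]
  refine ⟨integrable_exp_neg_sum_sq.comp_linearMap hne, ?_⟩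
  rw [integral_comp_linearMap volume hne fun A => Real.exp (-∑ i, ∑ j, A i j ^ 2),
    integral_exp_neg_sum_sq, hdet, abs_inv, abs_mul, abs_pow, abs_pow, hSabs, hTabs,
    Fintype.card_fin, Fintype.card_fin, Real.sqrt_eq_rpow, smul_eq_mul, Real.inv_rpow hCpos.le]
  simp only [← Real.rpow_natCast, ← Real.rpow_mul hBpos.le, ← Real.rpow_mul hCpos.le,
    ← Real.rpow_mul Real.pi_pos.le, ← Real.rpow_neg hCpos.le, mul_inv, ← Real.rpow_neg hBpos.le]
  ring_nf
end

section
/- Let 0 ≤ p < m < n and let B be a real symmetric positive definite n × n matrix. For 0 ≤ k < n write B_{>k} for the trailing principal submatrix of B on the indices k+1, …, n, and let S_k(B) := B_{≤k} − B_{≤k,>k} (B_{>k})⁻¹ B_{>k,≤k} be the k × k Schur complement of B with respect to B_{>k} (a positive definite matrix). Then: (i) S_p(S_m(B)) = S_p(B), i.e. the Schur complement onto the first p coordinates can be computed in two stages through the first m coordinates; and (ii) det(B_{>m}) · det((S_m(B))_{>p}) = det(B_{>p}), where (S_m(B))_{>p} denotes the trailing (m−p) × (m−p) principal submatrix of the m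 × m matrix S_m(B). (These two identities express the transitivity I^D_{E,G} = I^D_{F,G} ∘ I^D_{E,F} of the D-dimensional integral on Gaussian test functions exp(−tr(A B)).) -/
open Matrix

noncomputable section

/-- The leading principal `k × k` submatrix `B_{≤k}`. -/
def lead {n : ℕ} (k : ℕ) (hk : k ≤ n) (B : Matrix (Fin n) (Fin n) ℝ) :
    Matrix (Fin k) (Fin k) ℝ :=
  B.submatrix (Fin.castLE hk) (Fin.castLE hk)

/-- The embedding of the trailing indices `k+1, …, n`. -/
def trailEmb {n : ℕ} (k : ℕ) (hk : k ≤ n) : Fin (n - k) → Fin n :=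
  fun i => ⟨k + i.1, by omega⟩

/-- The trailing principal `(n−k) × (n−k)` submatrix `B_{>k}`. -/
def trail {n : ℕ} (k : ℕ) (hk : k ≤ n) (B : Matrix (Fin n) (Fin n) ℝ) :
    Matrix (Fin (n - k)) (Fin (n - k)) ℝ :=
  B.submatrix (trailEmb k hk) (trailEmb k hk)

/-- The off-diagonal block `B_{≤k,>k}`. -/
def offTR {n : ℕ} (k : ℕ) (hk : k ≤ n) (B : Matrix (Fin n) (Fin n) ℝ) :
    Matrix (Fin k) (Fin (n - k)) ℝ :=
  B.submatrix (Fin.castLE hk) (trailEmb k hk)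

/-- The off-diagonal block `B_{>k,≤k}`. -/
def offBL {n : ℕ} (k : ℕ) (hk : k ≤ n) (B : Matrix (Fin n) (Fin n) ℝ) :
    Matrix (Fin (n - k)) (Fin k) ℝ :=
  B.submatrix (trailEmb k hk) (Fin.castLE hk)

/-- The Schur complement `S_k(B) = B_{≤k} − B_{≤k,>k} (B_{>k})⁻¹ B_{>k,≤k}`. -/
def schurCompl {n : ℕ} (k : ℕ) (hk : k ≤ n) (B : Matrix (Fin n) (Fin n) ℝ) :
    Matrix (Fin k) (Fin k) ℝ :=
  lead k hk B - offTR k hk B * (trail k hk B)⁻¹ * offBL k hk B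

/-- The quotient formula for Schur complements of a matrix in three-by-three block form: eliminating
the last block of indices and then the middle one amounts to eliminating both at once. -/
theorem schur_quotient_fromBlocks {a b c : Type*} [Fintype b] [Fintype c]
    [DecidableEq b] [DecidableEq c] (A : Matrix a a ℝ) (Y : Matrix a b ℝ) (X : Matrix a c ℝ)
    (Y' : Matrix b a ℝ) (X' : Matrix c a ℝ) (E : Matrix b b ℝ) (F : Matrix b c ℝ)
    (G : Matrix c b ℝ) (H : Matrix c c ℝ) (hH : IsUnit H) (hE : IsUnit (fromBlocks E F G H)) :
    (A - X * H⁻¹ * X') - (Y - X * H⁻¹ * G) * (E - F * H⁻¹ * G)⁻¹ * (Y' - F * H⁻¹ * X') =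
      A - fromCols Y X * (fromBlocks E F G H)⁻¹ * fromRows Y' X' := by
  have := hH.invertible
  have := hE.invertible
  have := invertibleOfFromBlocks₂₂Invertible E F G H
  rw [← invOf_eq_nonsing_inv (fromBlocks E F G H), invOf_fromBlocks₂₂_eq,
    fromCols_mul_fromBlocks, fromCols_mul_fromRows]
  simp only [invOf_eq_nonsing_inv, Matrix.mul_sub, Matrix.sub_mul, Matrix.mul_add, Matrix.add_mul,
    Matrix.mul_neg, Matrix.neg_mul, Matrix.mul_assoc]
  abel

theorem trailEmb_injective {n : ℕ} (k : ℕ) (hk : k ≤ n) :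
    Function.Injective (trailEmb (n := n) k hk) := by
  intro i j h
  simpa [trailEmb, Fin.ext_iff] using h

/-- The indices after `p` split into those up to `m` and those after `m`. -/
def trailSplit {p m n : ℕ} (hpm : p ≤ m) (hmn : m ≤ n) :
    Fin (m - p) ⊕ Fin (n - m) ≃ Fin (n - p) :=
  finSumFinEquiv.trans (finCongr (by omega))

theorem trailEmb_trailSplit_inl {p m n : ℕ} (hpm : p ≤ m) (hmn : m ≤ n) (i : Fin (m - p)) :
    trailEmb p (hpm.trans hmn) (trailSplit hpm hmn (Sum.inl i)) =
      Fin.castLE hmn (trailEmb p hpm i) := by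
  simp [trailEmb, trailSplit]

theorem trailEmb_trailSplit_inr {p m n : ℕ} (hpm : p ≤ m) (hmn : m ≤ n) (i : Fin (n - m)) :
    trailEmb p (hpm.trans hmn) (trailSplit hpm hmn (Sum.inr i)) = trailEmb m hmn i := by
  simp only [trailEmb, trailSplit, Fin.ext_iff, Equiv.trans_apply, finSumFinEquiv_apply_right,
    finCongr_apply, Fin.val_cast, Fin.val_natAdd]
  omega

theorem trail_submatrix_trailSplit {p m n : ℕ} (hpm : p ≤ m) (hmn : m ≤ n)
    (B : Matrix (Fin n) (Fin n) ℝ) :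
    (trail p (hpm.trans hmn) B).submatrix (trailSplit hpm hmn) (trailSplit hpm hmn) =
      fromBlocks (trail p hpm (lead m hmn B)) ((offTR m hmn B).submatrix (trailEmb p hpm) id)
        ((offBL m hmn B).submatrix id (trailEmb p hpm)) (trail m hmn B) := by
  ext (i | i) (j | j) <;>
    simp [trail, lead, offTR, offBL, trailEmb_trailSplit_inl, trailEmb_trailSplit_inr]

theorem offTR_submatrix_trailSplit {p m n : ℕ} (hpm : p ≤ m) (hmn : m ≤ n)
    (B : Matrix (Fin n) (Fin n) ℝ) :
    (offTR p (hpm.trans hmn) B).submatrix id (trailSplit hpm hmn) =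
      fromCols (offTR p hpm (lead m hmn B))
        ((offTR m hmn B).submatrix (Fin.castLE hpm) id) := by
  ext i (j | j) <;>
    simp [lead, offTR, trailEmb_trailSplit_inl, trailEmb_trailSplit_inr]

theorem offBL_submatrix_trailSplit {p m n : ℕ} (hpm : p ≤ m) (hmn : m ≤ n)
    (B : Matrix (Fin n) (Fin n) ℝ) :
    (offBL p (hpm.trans hmn) B).submatrix (trailSplit hpm hmn) id =
      fromRows (offBL p hpm (lead m hmn B))
        ((offBL m hmn B).submatrix id (Fin.castLE hpm)) := by
  ext (i | i) j <;>
    simp [lead, offBL, trailEmb_trailSplit_inl, trailEmb_trailSplit_inr]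

/-- Transitivity of Schur complements.  For `0 ≤ p < m < n` and `B` symmetric
positive definite `n × n`: (i) `S_p(S_m(B)) = S_p(B)`, and
(ii) `det(B_{>m}) · det((S_m(B))_{>p}) = det(B_{>p})`. -/
theorem schur_complement_transitivity (p m n : ℕ) (hpm : p < m) (hmn : m < n)
    (B : Matrix (Fin n) (Fin n) ℝ) (hB : B.PosDef) (hBsymm : B.IsSymm) :
    schurCompl p hpm.le (schurCompl m hmn.le B) = schurCompl p (hpm.trans hmn).le B ∧
    (trail m hmn.le B).det * (trail p hpm.le (schurCompl m hmn.le B)).det =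
      (trail p (hpm.trans hmn).le B).det := by
  have hH : IsUnit (trail m hmn.le B) := (hB.submatrix (trailEmb_injective m hmn.le)).isUnit
  have hE := (hB.submatrix (trailEmb_injective p (hpm.trans hmn).le)).isUnit
  change IsUnit (trail p (hpm.trans hmn).le B) at hE
  have hsplit := trail_submatrix_trailSplit hpm.le hmn.le B
  constructor
  · have hblocks := (isUnit_submatrix_equiv (A := trail p (hpm.trans hmn).le B)
      (trailSplit hpm.le hmn.le) (trailSplit hpm.le hmn.le)).2 hE
    rw [hsplit] at hblocks
    have hquot := schur_quotient_fromBlocks (lead p hpm.le (lead m hmn.le B))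
      (offTR p hpm.le (lead m hmn.le B)) ((offTR m hmn.le B).submatrix (Fin.castLE hpm.le) id)
      (offBL p hpm.le (lead m hmn.le B)) ((offBL m hmn.le B).submatrix id (Fin.castLE hpm.le))
      _ _ _ _ hH hblocks
    rw [← hsplit, ← offTR_submatrix_trailSplit, ← offBL_submatrix_trailSplit,
      inv_submatrix_equiv, submatrix_mul_equiv, submatrix_mul_equiv] at hquot
    exact hquot
  · rw [← det_submatrix_equiv_self (trailSplit hpm.le hmn.le) (trail p (hpm.trans hmn).le B),
      hsplit]
    have := hH.invertible
    rw [det_fromBlocks₂₂, invOf_eq_nonsing_inv]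
    rfl

end
end

section
/- Let l ≥ 1, let Q : ℝˡ → ℝ be a polynomial function which takes (strictly) positive values at every point of the open orthant (0,∞)ˡ, and let g : ℝˡ → ℝ be a Schwartz function. Then: (i) for every D ∈ ℂ with Re D < 0 the function t ↦ g(t) · Q(t)^{−D/2} is integrable on (0,∞)ˡ; (ii) the function I(D) := ∫_{(0,∞)ˡ} g(t) Q(t)^{−D/2} dt is holomorphic on the half-plane {D ∈ ℂ : Re D < 0}; and (iii) there exists a function meromorphic on all of ℂ which agrees with I on that half-plane. -/
open MeasureTheory MvPolynomial

noncomputable section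

section Weyl

variable {K M τ : Type*} [Field K] [AddCommGroup M] [Module K M]

/-- The span of the vectors obtained from `v` by at most `j` applications of the operators `T`. -/
def orbitStage (T : τ → Module.End K M) (v : M) : ℕ → Submodule K M
  | 0 => Submodule.span K {v}
  | j + 1 => orbitStage T v j ⊔ ⨆ t, (orbitStage T v j).map (T t)

/-- The smallest subspace that contains `v` and is stable under the operators `T`. -/
def orbitSpan (T : τ → Module.End K M) (v : M) : Submodule K M := ⨆ j, orbitStage T v j

variable {T : τ → Module.End K M} {v : M}

lemma orbitStage_mono : Monotone (orbitStage T v) :=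
  monotone_nat_of_le_succ fun _ => le_sup_left

lemma apply_mem_orbitStage {j : ℕ} {w : M} (hw : w ∈ orbitStage T v j) (t : τ) :
    T t w ∈ orbitStage T v (j + 1) :=
  Submodule.mem_sup_right (Submodule.mem_iSup_of_mem t (Submodule.mem_map_of_mem hw))

lemma orbitStage_le {F : ℕ → Submodule K M} (hF : Monotone F)
    (hT : ∀ t k, ∀ w ∈ F k, T t w ∈ F (k + 1)) {k : ℕ} (hv : v ∈ F k) (j : ℕ) :
    orbitStage T v j ≤ F (k + j) := by
  induction j with
  | zero => simpa [orbitStage] using hv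
  | succ j ih =>
    refine sup_le (ih.trans (hF (by omega))) (iSup_le fun t => ?_)
    rintro _ ⟨w, hw, rfl⟩
    exact hT t _ _ (ih hw)

lemma orbitStage_le_orbitSpan (j : ℕ) : orbitStage T v j ≤ orbitSpan T v := le_iSup _ j

lemma self_mem_orbitSpan : v ∈ orbitSpan T v :=
  orbitStage_le_orbitSpan 0 (Submodule.mem_span_singleton_self v)

lemma apply_mem_orbitSpan {w : M} (hw : w ∈ orbitSpan T v) (t : τ) : T t w ∈ orbitSpan T v := by
  rw [orbitSpan, Submodule.mem_iSup_of_directed _ orbitStage_mono.directed_le] at hw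
  obtain ⟨j, hj⟩ := hw
  exact orbitStage_le_orbitSpan _ (apply_mem_orbitStage hj t)

lemma orbitSpan_le {S : Submodule K M} (hv : v ∈ S) (hT : ∀ t, ∀ w ∈ S, T t w ∈ S) :
    orbitSpan T v ≤ S :=
  iSup_le fun j => orbitStage_le (F := fun _ => S) monotone_const (fun t _ => hT t) (k := 0) hv j

instance [Finite τ] (j : ℕ) : FiniteDimensional K (orbitStage T v j) := by
  induction j with
  | zero => rw [orbitStage]; infer_instance
  | succ j ih => rw [orbitStage]; infer_instance

lemma map_orbitStage {M' : Type*} [AddCommGroup M'] [Module K M'] {T' : τ → Module.End K M'}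
    (φ : M →ₗ[K] M') (h : ∀ t w, φ (T t w) = T' t (φ w)) (j : ℕ) :
    (orbitStage T v j).map φ = orbitStage T' (φ v) j := by
  induction j with
  | zero => simp [orbitStage, Submodule.map_span]
  | succ j ih =>
    simp only [orbitStage, Submodule.map_sup, Submodule.map_iSup, ← ih, ← Submodule.map_comp]
    congr! 4 with t
    ext w
    exact h t w

end Weyl

lemma totalDegree_pderiv_le {σ R : Type*} [CommSemiring R] (c : MvPolynomial σ R) (t : σ) :
    (pderiv t c).totalDegree ≤ c.totalDegree - 1 := by
  classical
  refine Finset.sup_le fun m hm => ?_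
  rw [mem_support_iff, coeff_pderiv] at hm
  have := le_totalDegree (mem_support_iff.2 (left_ne_zero_of_mul hm))
  rw [Finsupp.sum_add_index' (by simp) (by simp), Finsupp.sum_single_index rfl] at this
  omega

lemma exists_pderiv_ne_zero {σ R : Type*} [CommRing R] [NoZeroDivisors R] [CharZero R]
    {c : MvPolynomial σ R} (hc : c.totalDegree ≠ 0) : ∃ t, pderiv t c ≠ 0 := by
  by_contra! h
  apply hc
  rw [totalDegree_eq_zero_iff]
  intro m hm t
  by_contra hmt
  have := congrArg (coeff (m - Finsupp.single t 1)) (h t)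
  rw [coeff_pderiv, tsub_add_cancel_of_le (by simpa [Nat.one_le_iff_ne_zero] using hmt), coeff_zero,
    mul_eq_zero] at this
  rcases this with h1 | h1
  · exact mem_support_iff.1 hm h1
  · exact Nat.cast_add_one_ne_zero _ h1

section Weyl

variable {K M σ : Type*} [Field K] [AddCommGroup M] [Module K M]

/-- Operators `X i` and `D i` satisfying the defining relations of the Weyl algebra. -/
structure WeylRelations [DecidableEq σ] (X D : σ → Module.End K M) : Prop where
  comm_X : ∀ i j, Commute (X i) (X j)
  comm_D : ∀ i j, Commute (D i) (D j)
  comm_DX : ∀ i j, D i * X j - X j * D i = if i = j then 1 else 0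

open scoped IsMulCommutative in
/-- Evaluation of polynomials at commuting operators. -/
lemma exists_aeval_of_commute {Y : σ → Module.End K M} (h : ∀ i j, Commute (Y i) (Y j)) :
    ∃ φ : MvPolynomial σ K →ₐ[K] Module.End K M, ∀ i, φ (MvPolynomial.X i) = Y i := by
  have := Algebra.isMulCommutative_adjoin K (s := Set.range Y)
    (by rintro _ ⟨i, rfl⟩ _ ⟨j, rfl⟩; exact h i j)
  refine ⟨(Algebra.adjoin K (Set.range Y)).val.comp
    (aeval fun i => ⟨Y i, Algebra.subset_adjoin ⟨i, rfl⟩⟩), fun i => by simp⟩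

end Weyl

section Weyl

variable {K M σ : Type*} [Field K] [AddCommGroup M] [Module K M] [DecidableEq σ]
  {X D : σ → Module.End K M}

lemma aeval_mul_sub {Y : σ → Module.End K M} {φ : MvPolynomial σ K →ₐ[K] Module.End K M}
    (hφ : ∀ i, φ (MvPolynomial.X i) = Y i) {Z : Module.End K M} {i : σ} {ε : K}
    (h : ∀ j, Z * Y j - Y j * Z = if i = j then ε • 1 else 0) (p : MvPolynomial σ K) :
    Z * φ p - φ p * Z = ε • φ (pderiv i p) := by
  induction p using MvPolynomial.induction_on with
  | C a =>
    rw [← algebraMap_eq, AlgHom.commutes, ← Algebra.commutes, sub_self, algebraMap_eq, pderiv_C,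
      map_zero, smul_zero]
  | add p q hp hq => rw [map_add, map_add, map_add, smul_add, ← hp, ← hq]; noncomm_ring
  | mul_X p j hp =>
    have : Z * φ (p * MvPolynomial.X j) - φ (p * MvPolynomial.X j) * Z
        = (Z * φ p - φ p * Z) * Y j + φ p * (Z * Y j - Y j * Z) := by
      rw [map_mul, hφ]; noncomm_ring
    rw [this, hp, h, pderiv_mul, map_add, map_mul, map_mul, hφ, pderiv_X]
    split_ifs with hij
    · subst hij; simp [smul_add]
    · simp [Pi.single_eq_of_ne (Ne.symm hij)]

/-- Normally ordered operators: a polynomial in the variables of `X` and of `D` acts linearly, with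
the commutators with `X i` and `D i` given by partial derivatives. -/
lemma exists_symbol (h : WeylRelations X D) :
    ∃ Φ : MvPolynomial (σ ⊕ σ) K →ₗ[K] Module.End K M,
      (∀ a, Φ (C a) = a • 1) ∧
      (∀ i c, Φ c * X i - X i * Φ c = Φ (pderiv (Sum.inr i) c)) ∧
      (∀ i c, D i * Φ c - Φ c * D i = Φ (pderiv (Sum.inl i) c)) ∧
      ∀ (v : M) (m : σ ⊕ σ →₀ ℕ) (k : ℕ), ∀ w ∈ orbitStage (Sum.elim X D) v k,
        Φ (monomial m 1) w ∈ orbitStage (Sum.elim X D) v (k + m.degree) := by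
  obtain ⟨φ, hφ⟩ := exists_aeval_of_commute h.comm_X
  obtain ⟨ψ, hψ⟩ := exists_aeval_of_commute h.comm_D
  let e := tensorEquivSum K σ σ K
  have he : ∀ p q, e (p ⊗ₜ q) = rename Sum.inl p * rename Sum.inr q := by
    have h1 : e.toAlgHom.comp Algebra.TensorProduct.includeLeft = rename Sum.inl := by
      ext i; simp [e]
    have h2 : e.toAlgHom.comp Algebra.TensorProduct.includeRight = rename Sum.inr := by
      ext i; simp [e]
    intro p q
    rw [← h1, ← h2]
    simp [← map_mul]
  let Φ : MvPolynomial (σ ⊕ σ) K →ₗ[K] Module.End K M :=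
    (TensorProduct.lift ((LinearMap.mul K (Module.End K M)).compl₁₂ φ.toLinearMap ψ.toLinearMap)) ∘ₗ
      e.symm.toLinearMap
  have hΦ : ∀ p q, Φ (rename Sum.inl p * rename Sum.inr q) = φ p * ψ q := by
    intro p q
    rw [← he]
    simp [Φ]
  have hl : ∀ i p q, pderiv (Sum.inl i) (rename Sum.inl p * rename Sum.inr q : MvPolynomial (σ ⊕ σ) K)
      = rename Sum.inl (pderiv i p) * rename Sum.inr q := by
    intro i p q
    have : pderiv (Sum.inl i) (rename Sum.inr q : MvPolynomial (σ ⊕ σ) K) = 0 := by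
      refine pderiv_eq_zero_of_notMem_vars fun hi => ?_
      simpa using vars_rename _ _ hi
    rw [pderiv_mul, pderiv_rename Sum.inl_injective, this, mul_zero, add_zero]
  have hr : ∀ i p q, pderiv (Sum.inr i) (rename Sum.inl p * rename Sum.inr q : MvPolynomial (σ ⊕ σ) K)
      = rename Sum.inl p * rename Sum.inr (pderiv i q) := by
    intro i p q
    have : pderiv (Sum.inr i) (rename Sum.inl p : MvPolynomial (σ ⊕ σ) K) = 0 := by
      refine pderiv_eq_zero_of_notMem_vars fun hi => ?_
      simpa using vars_rename _ _ hi
    rw [pderiv_mul, pderiv_rename Sum.inr_injective, this, zero_mul, zero_add]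
  have hind : ∀ P : MvPolynomial (σ ⊕ σ) K → Prop, P 0 → (∀ c d, P c → P d → P (c + d)) →
      (∀ p q, P (rename Sum.inl p * rename Sum.inr q)) → ∀ c, P c := by
    intro P h0 hadd hm c
    rw [← e.apply_symm_apply c]
    induction e.symm c using TensorProduct.induction_on with
    | zero => rwa [map_zero]
    | tmul p q => rw [he]; exact hm p q
    | add x y hx hy => rw [map_add]; exact hadd _ _ hx hy
  refine ⟨Φ, fun a => ?_, fun i c => ?_, fun i c => ?_, fun v m k w hw => ?_⟩
  · have := hΦ (C a) 1
    simpa [Algebra.algebraMap_eq_smul_one, ← algebraMap_eq] using this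
  · refine hind (fun c => Φ c * X i - X i * Φ c = Φ (pderiv (Sum.inr i) c)) (by simp) ?_ ?_ c
    · intro c d hc hd
      rw [map_add, map_add, map_add, ← hc, ← hd]
      noncomm_ring
    · intro p q
      have h1 : X i * φ p = φ p * X i := by
        simpa [sub_eq_zero] using aeval_mul_sub (i := i) (ε := 0) hφ (Z := X i)
          (by intro j; simp [(h.comm_X i j).eq]) p
      have h2 := aeval_mul_sub (i := i) (ε := -1) hψ (Z := X i)
          (by
            intro j
            rw [← neg_sub, h.comm_DX]
            simp only [eq_comm (a := i)]
            split_ifs <;> simp) q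
      rw [hr, hΦ, hΦ, ← mul_assoc, h1, mul_assoc, mul_assoc, ← mul_sub, ← neg_sub, h2]
      simp
  · refine hind (fun c => D i * Φ c - Φ c * D i = Φ (pderiv (Sum.inl i) c)) (by simp) ?_ ?_ c
    · intro c d hc hd
      rw [map_add, map_add, map_add, ← hc, ← hd]
      noncomm_ring
    · intro p q
      have h1 : D i * ψ q = ψ q * D i := by
        simpa [sub_eq_zero] using aeval_mul_sub (i := i) (ε := 0) hψ (Z := D i)
          (by intro j; simp [(h.comm_D i j).eq]) q
      have h2 := aeval_mul_sub (i := i) (ε := 1) hφ (Z := D i)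
          (by intro j; simp [h.comm_DX]) p
      rw [hl, hΦ, hΦ, mul_assoc, ← h1, ← mul_assoc, ← mul_assoc, ← sub_mul, h2, one_smul]
  · have hmon : ∀ (χ : MvPolynomial σ K →ₐ[K] Module.End K M) (f : σ → σ ⊕ σ),
        (∀ i, χ (MvPolynomial.X i) = Sum.elim X D (f i)) → ∀ (m : σ →₀ ℕ) (k : ℕ),
        ∀ w ∈ orbitStage (Sum.elim X D) v k,
          χ (monomial m 1) w ∈ orbitStage (Sum.elim X D) v (k + m.degree) := by
      intro χ f hχ m
      induction m using Finsupp.induction_linear with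
      | zero =>
        intro k w hw
        have : (monomial (0 : σ →₀ ℕ) (1 : K)) = 1 := rfl
        simpa [this] using hw
      | add m m' hm hm' =>
        intro k w hw
        rw [← one_mul (1 : K), ← monomial_mul, map_mul, map_add, add_comm m.degree, ← add_assoc]
        exact hm _ _ (hm' _ _ hw)
      | single i n =>
        induction n with
        | zero =>
          intro k w hw
          have : (monomial (Finsupp.single i 0) (1 : K)) = 1 := by simp
          simpa [this] using hw
        | succ n ih =>
          intro k w hw
          have : (monomial (Finsupp.single i (n + 1)) (1 : K))
              = MvPolynomial.X i * monomial (Finsupp.single i n) 1 := by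
            rw [← X_pow_eq_monomial, ← X_pow_eq_monomial, pow_succ']
          rw [this, map_mul, hχ, Finsupp.degree_single, ← add_assoc]
          have := ih k w hw
          rw [Finsupp.degree_single] at this
          exact apply_mem_orbitStage this _
    have h0 : m = (m.comapDomain Sum.inl Sum.inl_injective.injOn).mapDomain Sum.inl
        + (m.comapDomain Sum.inr Sum.inr_injective.injOn).mapDomain Sum.inr := by
      refine Finsupp.ext ?_
      rintro (i | i)
      · rw [Finsupp.add_apply, Finsupp.mapDomain_apply Sum.inl_injective,
          Finsupp.mapDomain_of_notMem_range _ _ (by simp)]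
        simp
      · rw [Finsupp.add_apply, Finsupp.mapDomain_apply Sum.inr_injective,
          Finsupp.mapDomain_of_notMem_range _ _ (by simp)]
        simp
    set a := m.comapDomain Sum.inl Sum.inl_injective.injOn
    set b := m.comapDomain Sum.inr Sum.inr_injective.injOn
    have h1 : (monomial m (1 : K)) = rename Sum.inl (monomial a 1) * rename Sum.inr (monomial b 1) := by
      rw [rename_monomial, rename_monomial, monomial_mul, one_mul, ← h0]
    have h2 : m.degree = b.degree + a.degree := by
      rw [h0, map_add, Finsupp.degree_mapDomain, Finsupp.degree_mapDomain, add_comm]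
    rw [h1, hΦ, h2, ← add_assoc]
    exact hmon φ Sum.inl hφ a _ _ (hmon ψ Sum.inr hψ b _ _ hw)

omit [DecidableEq σ] in
lemma exists_symbol_apply_ne_zero [CharZero K] {Φ : MvPolynomial (σ ⊕ σ) K →ₗ[K] Module.End K M}
    (hC : ∀ a, Φ (C a) = a • 1)
    (hX : ∀ i c, Φ c * X i - X i * Φ c = Φ (pderiv (Sum.inr i) c))
    (hD : ∀ i c, D i * Φ c - Φ c * D i = Φ (pderiv (Sum.inl i) c))
    {v : M} (hv : v ≠ 0) (j : ℕ) {c : MvPolynomial (σ ⊕ σ) K} (hc : c ≠ 0)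
    (hj : c.totalDegree ≤ j) :
    ∃ w ∈ orbitStage (Sum.elim X D) v j, Φ c w ≠ 0 := by
  induction j generalizing c with
  | zero =>
    rw [Nat.le_zero, totalDegree_eq_zero_iff_eq_C] at hj
    refine ⟨v, Submodule.mem_span_singleton_self v, ?_⟩
    rw [hj, hC]
    refine smul_ne_zero (fun h0 => hc ?_) hv
    rw [hj, h0, C_0]
  | succ j ih =>
    by_cases h0 : c.totalDegree = 0
    · obtain ⟨w, hw, hne⟩ := ih hc (by omega)
      exact ⟨w, orbitStage_mono (Nat.le_succ j) hw, hne⟩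
    obtain ⟨t, ht⟩ := exists_pderiv_ne_zero h0
    obtain ⟨w, hw, hne⟩ := ih ht ((totalDegree_pderiv_le c t).trans (by omega))
    by_contra! hall
    have h1 := hall w (orbitStage_mono (Nat.le_succ j) hw)
    have h2 := hall _ (apply_mem_orbitStage hw t.swap)
    apply hne
    cases t with
    | inl i => simpa [h1, show Φ c (D i w) = 0 from h2] using (LinearMap.congr_fun (hD i c) w).symm
    | inr i => simpa [h1, show Φ c (X i w) = 0 from h2] using (LinearMap.congr_fun (hX i c) w).symm

/-- Bernstein's inequality for the growth of cyclic modules over the Weyl algebra. -/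
lemma pow_le_finrank_orbitStage_mul [CharZero K] [Fintype σ] (h : WeylRelations X D) {v : M}
    (hv : v ≠ 0) (i : ℕ) :
    (i + 1) ^ (2 * Fintype.card σ) ≤
      Module.finrank K (orbitStage (Sum.elim X D) v (2 * Fintype.card σ * i)) *
      Module.finrank K (orbitStage (Sum.elim X D) v (2 * (2 * Fintype.card σ * i))) := by
  obtain ⟨Φ, hC, hX, hD, hm⟩ := exists_symbol h
  set J := 2 * Fintype.card σ * i
  set V := orbitStage (Sum.elim X D) v
  let mon : (σ ⊕ σ → Fin (i + 1)) → (σ ⊕ σ →₀ ℕ) :=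
    fun e => Finsupp.equivFunOnFinite.symm fun t => (e t : ℕ)
  have hmon : Function.Injective mon := by
    intro e e' hee
    ext t
    exact DFunLike.congr_fun hee t
  have hdeg : ∀ e, (mon e).degree ≤ J := by
    intro e
    rw [Finsupp.degree_eq_sum]
    refine (Finset.sum_le_card_nsmul _ _ i fun t _ => ?_).trans ?_
    · exact Nat.lt_succ_iff.1 (e t).2
    · simp [J, two_mul]
  let P : ((σ ⊕ σ → Fin (i + 1)) → K) →ₗ[K] MvPolynomial (σ ⊕ σ) K :=
    Fintype.linearCombination K fun e => monomial (mon e) 1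
  have hP : Function.Injective P := by
    have := ((basisMonomials (σ ⊕ σ) K).linearIndependent).comp mon hmon
    rw [coe_basisMonomials] at this
    exact this.fintypeLinearCombination_injective
  have hPdeg : ∀ a, (P a).totalDegree ≤ J := by
    intro a
    rw [Fintype.linearCombination_apply]
    refine totalDegree_finsetSum_le fun e _ => ?_
    refine (totalDegree_smul_le _ _).trans ((totalDegree_monomial_le _ _).trans (hdeg e))
  have hmem : ∀ a, ∀ w ∈ V J, Φ (P a) w ∈ V (2 * J) := by
    intro a w hw
    rw [Fintype.linearCombination_apply, map_sum, LinearMap.sum_apply]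
    refine Submodule.sum_mem _ fun e _ => ?_
    rw [map_smul]
    refine Submodule.smul_mem _ _ (orbitStage_mono ?_ (hm v (mon e) J w hw))
    have := hdeg e
    omega
  let Ψ : ((σ ⊕ σ → Fin (i + 1)) → K) →ₗ[K] (V J →ₗ[K] V (2 * J)) :=
    { toFun := fun a => (Φ (P a)).restrict (hmem a)
      map_add' := fun a b => by ext w; simp
      map_smul' := fun a b => by ext w; simp }
  have hΨ : Function.Injective Ψ := by
    rw [injective_iff_map_eq_zero]
    intro a ha
    by_contra hne
    obtain ⟨w, hw, hw'⟩ := exists_symbol_apply_ne_zero hC hX hD hv J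
      ((map_ne_zero_iff P hP).2 hne) (hPdeg a)
    exact hw' (congrArg Subtype.val (LinearMap.congr_fun ha ⟨w, hw⟩))
  have := LinearMap.finrank_le_finrank_of_injective hΨ
  rw [Module.finrank_linearMap, Module.finrank_fintype_fun_eq_card] at this
  refine le_trans (le_of_eq ?_) this
  simp [two_mul]

end Weyl

section Holonomic

variable {K M σ : Type*} [Field K] [AddCommGroup M] [Module K M]

lemma sum_finrank_map_mkQ_le (F : Submodule K M) [FiniteDimensional K F] {W : ℕ → Submodule K M}
    {U : ℕ → Submodule K M} (hUF : ∀ a, U a ≤ W a) (m : ℕ) (hF : ∀ a < m, U a ≤ F)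
    (hW : Antitone W) :
    ∑ a ∈ Finset.range m, Module.finrank K ((U a).map (W (a + 1)).mkQ) +
      Module.finrank K (F ⊓ W m : Submodule K M) ≤ Module.finrank K F := by
  induction m with
  | zero => simpa using Submodule.finrank_mono inf_le_left
  | succ m ih =>
    refine le_trans ?_ (ih fun a ha => hF a (by omega))
    rw [Finset.sum_range_succ, add_assoc]
    gcongr
    set A : Submodule K M := F ⊓ W m
    have h := LinearMap.finrank_range_add_finrank_ker ((W (m + 1)).mkQ ∘ₗ A.subtype)
    rw [LinearMap.ker_comp, Submodule.ker_mkQ, LinearMap.range_comp, Submodule.range_subtype,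
      ← Submodule.finrank_map_subtype_eq, Submodule.map_comap_subtype] at h
    rw [← h]
    gcongr
    · exact Submodule.finrank_mono (Submodule.map_mono (le_inf (hF m (by omega)) (hUF m)))
    · exact Submodule.finrank_mono
        (le_inf (inf_le_inf_left F (hW (Nat.le_succ m))) inf_le_right)

lemma WeylRelations.mapQ [DecidableEq σ] {X D : σ → Module.End K M} (h : WeylRelations X D)
    {W : Submodule K M} (hX : ∀ i, W ≤ W.comap (X i)) (hD : ∀ i, W ≤ W.comap (D i)) :
    WeylRelations (fun i => W.mapQ W (X i) (hX i)) (fun i => W.mapQ W (D i) (hD i)) where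
  comm_X i j := by
    ext w
    simpa using congrArg W.mkQ (LinearMap.congr_fun (h.comm_X i j) w)
  comm_D i j := by
    ext w
    simpa using congrArg W.mkQ (LinearMap.congr_fun (h.comm_D i j) w)
  comm_DX i j := by
    ext w
    have := congrArg W.mkQ (LinearMap.congr_fun (h.comm_DX i j) w)
    split_ifs at this ⊢ <;> simpa using this

/-- In a module over the Weyl algebra in `n` variables with a filtration whose dimensions grow
like the `n`-th power, every decreasing sequence of cyclic submodules is not strictly decreasing. -/
theorem WeylRelations.exists_mem_orbitSpan_succ [CharZero K] [Fintype σ] [DecidableEq σ]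
    {X D : σ → Module.End K M} (h : WeylRelations X D) {F : ℕ → Submodule K M} (hF : Monotone F)
    [∀ k, FiniteDimensional K (F k)] (hstable : ∀ t k, ∀ w ∈ F k, Sum.elim X D t w ∈ F (k + 1))
    {C : ℕ} (hC : ∀ k, Module.finrank K (F k) ≤ (C * (k + 1)) ^ Fintype.card σ) {w : ℕ → M}
    (hwF : ∀ a, ∃ k, w a ∈ F k) (hw : ∀ a, w (a + 1) ∈ orbitSpan (Sum.elim X D) (w a)) :
    ∃ a, w a ∈ orbitSpan (Sum.elim X D) (w (a + 1)) := by
  by_contra! hcon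
  set n := Fintype.card σ
  set T := Sum.elim X D
  let W : ℕ → Submodule K M := fun a => orbitSpan T (w a)
  have hWT : ∀ a t, W a ≤ (W a).comap (T t) := fun a t u hu => apply_mem_orbitSpan hu t
  have hWanti : Antitone W := antitone_nat_of_succ_le fun a =>
    orbitSpan_le (hw a) fun t u hu => hWT a t hu
  set m := (C * (4 * n + 1)) ^ (2 * n) + 1 with hm
  choose k hk using hwF
  set k₀ := (Finset.range m).sup k
  have hk₀ : ∀ a < m, w a ∈ F k₀ := fun a ha =>
    hF (Finset.le_sup (Finset.mem_range.2 ha)) (hk a)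
  set J := 2 * n * k₀
  let d : ℕ → ℕ → ℕ := fun a j =>
    Module.finrank K ((orbitStage T (w a) j).map (W (a + 1)).mkQ)
  have hstage : ∀ a < m, ∀ j, orbitStage T (w a) j ≤ F (k₀ + j) := fun a ha j =>
    orbitStage_le hF hstable (hk₀ a ha) j
  have hd : ∀ a < m, ∀ j, d a j ≤ (C * (k₀ + j + 1)) ^ n := fun a ha j =>
    (Submodule.finrank_map_le _ _).trans ((Submodule.finrank_mono (hstage a ha j)).trans (hC _))
  have hlow : ∀ a, (k₀ + 1) ^ (2 * n) ≤ d a J * d a (2 * J) := by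
    intro a
    have hrel := h.mapQ (W := W (a + 1)) (fun i => hWT (a + 1) (Sum.inl i))
      (fun i => hWT (a + 1) (Sum.inr i))
    have hne : (W (a + 1)).mkQ (w a) ≠ 0 := by
      simpa [Submodule.Quotient.mk_eq_zero] using hcon a
    have := pow_le_finrank_orbitStage_mul hrel hne k₀
    rwa [← map_orbitStage (T := T), ← map_orbitStage (T := T)] at this <;>
    · rintro (i | i) u <;> rfl
  have hsum : ∑ a ∈ Finset.range m, d a J ≤ (C * (k₀ + J + 1)) ^ n :=
    (Nat.le_add_right _ _).trans ((sum_finrank_map_mkQ_le (F (k₀ + J)) (W := W)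
      (U := fun a => orbitStage T (w a) J) (fun a => orbitStage_le_orbitSpan J) m
      (fun a ha => hstage a ha J) hWanti).trans (hC _))
  have hle : k₀ + 2 * J + 1 ≤ (4 * n + 1) * (k₀ + 1) := by
    simp only [J]
    nlinarith
  have key : m * (k₀ + 1) ^ (2 * n) ≤ (C * (4 * n + 1)) ^ (2 * n) * (k₀ + 1) ^ (2 * n) := calc
    m * (k₀ + 1) ^ (2 * n) = ∑ a ∈ Finset.range m, (k₀ + 1) ^ (2 * n) := by simp
    _ ≤ ∑ a ∈ Finset.range m, d a J * (C * (k₀ + 2 * J + 1)) ^ n := by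
      refine Finset.sum_le_sum fun a ha => (hlow a).trans ?_
      gcongr
      exact hd a (Finset.mem_range.1 ha) _
    _ = (∑ a ∈ Finset.range m, d a J) * (C * (k₀ + 2 * J + 1)) ^ n := by rw [Finset.sum_mul]
    _ ≤ (C * (k₀ + 2 * J + 1)) ^ n * (C * (k₀ + 2 * J + 1)) ^ n := by
      gcongr
      refine hsum.trans ?_
      gcongr
      omega
    _ = (C * (k₀ + 2 * J + 1)) ^ (2 * n) := by rw [two_mul n, pow_add]
    _ ≤ (C * ((4 * n + 1) * (k₀ + 1))) ^ (2 * n) := by gcongr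
    _ = _ := by rw [← mul_assoc, mul_pow]
  have := Nat.le_of_mul_le_mul_right key (by positivity)
  omega

end Holonomic

open scoped TensorProduct in
/-- A derivation of an integral domain extends to its field of fractions. -/
lemma exists_derivation_extend {K R L : Type*} [CommRing K] [CommRing R] [Algebra K R] [Field L]
    [Algebra R L] [IsFractionRing R L] [Algebra K L] [IsScalarTower K R L]
    (d : Derivation K R R) :
    ∃ d' : Derivation K L L, ∀ p, d' (algebraMap R L p) = algebraMap R L (d p) := by
  have : Algebra.FormallyEtale R L := Algebra.FormallyEtale.of_isLocalization (nonZeroDivisors R)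
  let φ : Ω[R⁄K] →ₗ[R] L := (Algebra.linearMap R L).comp d.liftKaehlerDifferential
  let ψ : L ⊗[R] Ω[R⁄K] →ₗ[L] L := φ.liftBaseChange L
  refine ⟨(ψ.comp
    (KaehlerDifferential.tensorKaehlerEquivOfFormallyEtale K R L).symm.toLinearMap).compDer
      (KaehlerDifferential.D K L), fun p => ?_⟩
  have := KaehlerDifferential.tensorKaehlerEquivOfFormallyEtale_symm_D_algebraMap K R L p
  simp [this, ψ, φ]

lemma pderiv_comm {σ R : Type*} [CommRing R] (i j : σ) (p : MvPolynomial σ R) :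
    pderiv i (pderiv j p) = pderiv j (pderiv i p) := by
  have : ⁅(pderiv i : Derivation R (MvPolynomial σ R) (MvPolynomial σ R)), (pderiv j : Derivation R _ _)⁆ = 0 := by
    classical
    refine derivation_ext fun k => ?_
    rw [Derivation.commutator_apply]
    simp [pderiv_X, Pi.single_apply, apply_ite]
  have := congrArg (fun d => d p) this
  simpa [Derivation.commutator_apply, sub_eq_zero] using this

lemma derivation_fractionRing_ext {K R L : Type*} [CommRing K] [CommRing R] [IsDomain R]
    [Algebra K R] [Field L]
    [Algebra R L] [IsFractionRing R L] [Algebra K L] [IsScalarTower K R L]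
    {d d' : Derivation K L L} (h : ∀ p, d (algebraMap R L p) = d' (algebraMap R L p)) :
    d = d' := by
  ext x
  obtain ⟨p, q, hq, rfl⟩ := IsFractionRing.div_surjective (A := R) x
  rw [Derivation.leibniz_div, Derivation.leibniz_div, h, h]

section Twisted

variable {K σ : Type*} [Field K]

/-- The partial derivative on the field of rational functions. -/
def fracPderiv (i : σ) :
    Derivation K (FractionRing (MvPolynomial σ K)) (FractionRing (MvPolynomial σ K)) :=
  (exists_derivation_extend (pderiv i)).choose

lemma fracPderiv_algebraMap (i : σ) (p : MvPolynomial σ K) :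
    fracPderiv i (algebraMap _ (FractionRing (MvPolynomial σ K)) p) = algebraMap _ _ (pderiv i p) :=
  (exists_derivation_extend (pderiv i)).choose_spec p

lemma fracPderiv_comm (i j : σ) (w : FractionRing (MvPolynomial σ K)) :
    fracPderiv i (fracPderiv j w) = fracPderiv j (fracPderiv i w) := by
  have : ⁅(fracPderiv i : Derivation K (FractionRing (MvPolynomial σ K)) _),
      (fracPderiv j : Derivation K _ _)⁆ = 0 := by
    refine derivation_fractionRing_ext (R := MvPolynomial σ K) fun p => ?_
    simp [Derivation.commutator_apply, fracPderiv_algebraMap, pderiv_comm i j]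
  have := congrArg (fun d => d w) this
  simpa [Derivation.commutator_apply, sub_eq_zero] using this

/-- Multiplication by a variable on rational functions. -/
def mulVar (i : σ) : Module.End K (FractionRing (MvPolynomial σ K)) :=
  LinearMap.mulLeft K (algebraMap (MvPolynomial σ K) _ (X i))

/-- The operator `w ↦ f⁻ˢ ∂ᵢ (w fˢ)` on rational functions. -/
def twistedPderiv (s : K) (f : MvPolynomial σ K) (i : σ) :
    Module.End K (FractionRing (MvPolynomial σ K)) :=
  (fracPderiv i).toLinearMap +
    LinearMap.mulLeft K (s • (algebraMap _ _ (pderiv i f) / algebraMap _ _ f))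

lemma mulVar_apply (i : σ) (w : FractionRing (MvPolynomial σ K)) :
    mulVar i w = algebraMap (MvPolynomial σ K) _ (X i) * w := rfl

lemma twistedPderiv_apply (s : K) (f : MvPolynomial σ K) (i : σ)
    (w : FractionRing (MvPolynomial σ K)) : twistedPderiv s f i w =
      fracPderiv i w + s • (algebraMap _ _ (pderiv i f) / algebraMap _ _ f) * w := rfl

lemma weylRelations_twisted [DecidableEq σ] (s : K) {f : MvPolynomial σ K} (hf : f ≠ 0) :
    WeylRelations mulVar (twistedPderiv s f) where
  comm_X i j := by
    ext w
    simp only [Module.End.mul_apply, mulVar_apply]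
    ring
  comm_D i j := by
    ext w
    have h0 : algebraMap _ (FractionRing (MvPolynomial σ K)) f ≠ 0 := by simpa using hf
    simp only [Module.End.mul_apply, twistedPderiv_apply, map_add, Derivation.leibniz,
      Derivation.map_algebraMap, Derivation.leibniz_div, fracPderiv_algebraMap, fracPderiv_comm i j w,
      pderiv_comm i j f, smul_eq_mul, Algebra.smul_def]
    field_simp
    ring
  comm_DX i j := by
    ext w
    simp only [Module.End.mul_apply, LinearMap.sub_apply, mulVar_apply, twistedPderiv_apply,
      Derivation.leibniz, fracPderiv_algebraMap, pderiv_X, smul_eq_mul, Pi.single_apply,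
      Algebra.smul_def]
    split_ifs with h h' h' <;> simp_all <;> ring

lemma twistedPderiv_div (s : K) {f : MvPolynomial σ K} (hf : f ≠ 0) (i : σ)
    (p : MvPolynomial σ K) (k : ℕ) :
    twistedPderiv s f i (algebraMap _ _ p / algebraMap _ _ f ^ k) =
      algebraMap _ _ (f * pderiv i p + C (s - k) * pderiv i f * p) / algebraMap _ _ f ^ (k + 1) := by
  have h0 : algebraMap _ (FractionRing (MvPolynomial σ K)) f ≠ 0 := by simpa using hf
  have hC : algebraMap _ (FractionRing (MvPolynomial σ K)) (C s) = algebraMap K _ s :=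
    (IsScalarTower.algebraMap_apply K (MvPolynomial σ K) _ s).symm
  rw [twistedPderiv_apply, Derivation.leibniz_div, Derivation.leibniz_pow, fracPderiv_algebraMap,
    fracPderiv_algebraMap]
  rcases k with _ | k
  · simp [Algebra.smul_def, hC]
    field_simp
  · simp [Algebra.smul_def, hC]
    field_simp
    ring

end Twisted

section Twisted

variable {K σ : Type*} [Field K]

lemma finrank_restrictTotalDegree_le [Fintype σ] (N : ℕ) :
    Module.finrank K (restrictTotalDegree σ K N) ≤ (N + 1) ^ Fintype.card σ := by
  classical
  have hle : restrictTotalDegree σ K N ≤ Submodule.span K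
      (Set.range fun m : σ → Fin (N + 1) =>
        monomial (Finsupp.equivFunOnFinite.symm fun i => (m i : ℕ)) (1 : K)) := by
    refine (restrictTotalDegree_le_restrictDegree σ K N).trans ?_
    rw [restrictDegree, restrictSupport_eq_span, Submodule.span_le]
    rintro _ ⟨m, hm, rfl⟩
    refine Submodule.subset_span ⟨fun i => ⟨m i, Nat.lt_succ_of_le (hm i)⟩, ?_⟩
    exact congrArg (fun m => monomial m (1 : K)) (Finsupp.ext fun i => rfl)
  have : FiniteDimensional K (Submodule.span K
      (Set.range fun m : σ → Fin (N + 1) =>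
        monomial (Finsupp.equivFunOnFinite.symm fun i => (m i : ℕ)) (1 : K))) :=
    FiniteDimensional.span_of_finite K (Set.finite_range _)
  have := Submodule.finrank_mono hle
  refine this.trans ((finrank_range_le_card _).trans (by simp))

/-- The rational functions `p / f ^ k` with `p` of degree at most `k * (deg f + 1)`. -/
def poleStage (f : MvPolynomial σ K) (k : ℕ) :
    Submodule K (FractionRing (MvPolynomial σ K)) :=
  (restrictTotalDegree σ K (k * (f.totalDegree + 1))).map
    ((LinearMap.mulRight K (algebraMap _ _ f ^ k)⁻¹).comp
      (Algebra.linearMap (MvPolynomial σ K) _ |>.restrictScalars K))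

lemma mem_poleStage {f : MvPolynomial σ K} {k : ℕ} {w : FractionRing (MvPolynomial σ K)} :
    w ∈ poleStage f k ↔ ∃ p : MvPolynomial σ K, p.totalDegree ≤ k * (f.totalDegree + 1) ∧
      algebraMap _ _ p / algebraMap _ _ f ^ k = w := by
  simp [poleStage, mem_restrictTotalDegree, div_eq_mul_inv]

instance [Finite σ] (f : MvPolynomial σ K) (k : ℕ) : FiniteDimensional K (poleStage f k) := by
  rw [poleStage]; infer_instance

lemma finrank_poleStage_le [Fintype σ] (f : MvPolynomial σ K) (k : ℕ) :
    Module.finrank K (poleStage f k) ≤ ((f.totalDegree + 1) * (k + 1)) ^ Fintype.card σ := by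
  refine (Submodule.finrank_map_le _ _).trans ((finrank_restrictTotalDegree_le _).trans ?_)
  gcongr
  linarith

lemma poleStage_mono {f : MvPolynomial σ K} (hf : f ≠ 0) : Monotone (poleStage f) := by
  refine monotone_nat_of_le_succ fun k w hw => ?_
  obtain ⟨p, hp, rfl⟩ := mem_poleStage.1 hw
  have h0 : algebraMap _ (FractionRing (MvPolynomial σ K)) f ≠ 0 := by simpa using hf
  refine mem_poleStage.2 ⟨f * p, (totalDegree_mul _ _).trans (by linarith), ?_⟩
  rw [map_mul, pow_succ', mul_div_mul_left _ _ h0]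

lemma sumElim_mem_poleStage (s : K) {f : MvPolynomial σ K} (hf : f ≠ 0) (t : σ ⊕ σ) (k : ℕ)
    {w : FractionRing (MvPolynomial σ K)} (hw : w ∈ poleStage f k) :
    Sum.elim mulVar (twistedPderiv s f) t w ∈ poleStage f (k + 1) := by
  obtain ⟨p, hp, rfl⟩ := mem_poleStage.1 hw
  have h0 : algebraMap _ (FractionRing (MvPolynomial σ K)) f ≠ 0 := by simpa using hf
  rcases t with i | i
  · refine mem_poleStage.2 ⟨f * (X i * p), ?_, ?_⟩
    · have := totalDegree_mul f (X i * p)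
      have := totalDegree_mul (X i) p
      have := totalDegree_X (R := K) i
      linarith
    · simp only [map_mul, Sum.elim_inl, mulVar_apply, pow_succ',
        mul_div_mul_left _ _ h0, mul_div_assoc]
  · rw [Sum.elim_inr, twistedPderiv_div s hf]
    refine mem_poleStage.2 ⟨_, (totalDegree_add _ _).trans (max_le ?_ ?_), rfl⟩
    · have := totalDegree_mul f (pderiv i p)
      have := totalDegree_pderiv_le p i
      have : p.totalDegree - 1 ≤ p.totalDegree := Nat.sub_le _ _
      linarith
    · have := totalDegree_mul (C (s - k) * pderiv i f) p
      have := totalDegree_mul (C (s - k)) (pderiv i f)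
      have := totalDegree_C (σ := σ) (s - k)
      have := totalDegree_pderiv_le f i
      have : f.totalDegree - 1 ≤ f.totalDegree := Nat.sub_le _ _
      linarith

lemma algebraMap_mul_mem_orbitSpan {D : σ → Module.End K (FractionRing (MvPolynomial σ K))}
    {v w : FractionRing (MvPolynomial σ K)} (hw : w ∈ orbitSpan (Sum.elim mulVar D) v)
    (p : MvPolynomial σ K) : algebraMap _ _ p * w ∈ orbitSpan (Sum.elim mulVar D) v := by
  induction p using MvPolynomial.induction_on generalizing w with
  | C a =>
    have := Submodule.smul_mem _ a hw
    rwa [Algebra.smul_def, IsScalarTower.algebraMap_apply K (MvPolynomial σ K)] at this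
  | add p q hp hq => rw [map_add, add_mul]; exact Submodule.add_mem _ (hp hw) (hq hw)
  | mul_X p i hp =>
    rw [map_mul, mul_assoc]
    exact hp (apply_mem_orbitSpan hw (Sum.inl i))

/-- The functional equation of Bernstein: modulo the twist by `s`, some power of `f` lies in the
module generated by the next power. -/
theorem exists_pow_mem_orbitSpan_pow_succ [CharZero K] [Finite σ] (s : K)
    {f : MvPolynomial σ K} (hf : f ≠ 0) :
    ∃ a : ℕ, algebraMap _ (FractionRing (MvPolynomial σ K)) f ^ a ∈
      orbitSpan (Sum.elim mulVar (twistedPderiv s f)) (algebraMap _ _ f ^ (a + 1)) := by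
  classical
  have := Fintype.ofFinite σ
  have h0 : algebraMap _ (FractionRing (MvPolynomial σ K)) f ≠ 0 := by simpa using hf
  refine (weylRelations_twisted s hf).exists_mem_orbitSpan_succ (poleStage_mono hf)
    (fun t k w hw => sumElim_mem_poleStage s hf t k hw) (finrank_poleStage_le f)
    (w := fun a => algebraMap _ _ f ^ a) (fun a => ⟨a * f.totalDegree, ?_⟩) fun a => ?_
  · refine mem_poleStage.2 ⟨f ^ (a + a * f.totalDegree), (totalDegree_pow _ _).trans ?_, ?_⟩
    · linarith
    · rw [map_pow, pow_add, mul_div_assoc, div_self (pow_ne_zero _ h0), mul_one]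
  · rw [pow_succ']
    exact algebraMap_mul_mem_orbitSpan self_mem_orbitSpan f

end Twisted

section SchwartzPolynomial

open scoped SchwartzMap LineDeriv

variable {τ : Type*}

/-- A complex polynomial as a function on real points. -/
def polyFun (q : MvPolynomial τ ℂ) (t : τ → ℝ) : ℂ := eval (fun i => (t i : ℂ)) q

lemma polyFun_map_ofReal (P : MvPolynomial τ ℝ) (t : τ → ℝ) :
    polyFun (map Complex.ofRealHom P) t = (eval t P : ℝ) := by
  rw [polyFun, eval_map, ← Complex.ofRealHom_eq_coe, eval, coe_eval₂Hom, hom_eval₂]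
  rfl

@[simp] lemma polyFun_C (a : ℂ) (t : τ → ℝ) : polyFun (C a) t = a := by simp [polyFun]

@[simp] lemma polyFun_X (i : τ) (t : τ → ℝ) : polyFun (X i) t = t i := by simp [polyFun]

@[simp] lemma polyFun_add (p q : MvPolynomial τ ℂ) (t : τ → ℝ) :
    polyFun (p + q) t = polyFun p t + polyFun q t := by simp [polyFun]

@[simp] lemma polyFun_mul (p q : MvPolynomial τ ℂ) (t : τ → ℝ) :
    polyFun (p * q) t = polyFun p t * polyFun q t := by simp [polyFun]

lemma hasLineDerivAt_polyFun [DecidableEq τ] (q : MvPolynomial τ ℂ) (t : τ → ℝ) (i : τ) :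
    HasDerivAt (fun x : ℝ => polyFun q (t + x • Pi.single i 1)) (polyFun (pderiv i q) t) 0 := by
  induction q using MvPolynomial.induction_on with
  | C a => simpa [polyFun] using hasDerivAt_const (0 : ℝ) a
  | add p q hp hq =>
    rw [map_add, polyFun_add]
    exact (hp.add hq).congr_of_eventuallyEq (by filter_upwards with x; simp)
  | mul_X p j hp =>
    have h1 : HasDerivAt (fun x : ℝ => ((t j + x * (Pi.single i 1 : τ → ℝ) j : ℝ) : ℂ))
        (((Pi.single i 1 : τ → ℝ) j : ℝ) : ℂ) 0 := by
      have h2 := ((hasDerivAt_id (0 : ℝ)).mul_const ((Pi.single i 1 : τ → ℝ) j)).const_add (t j)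
      simpa using h2.ofReal_comp
    refine ((hp.mul h1).congr_of_eventuallyEq (by filter_upwards with x; simp)).congr_deriv ?_
    by_cases h : j = i
    · subst h
      simp [add_comm, mul_comm]
    · simp [pderiv_X_of_ne h, h, mul_comm]

variable [Fintype τ]

lemma hasTemperateGrowth_polyFun (q : MvPolynomial τ ℂ) : (polyFun q).HasTemperateGrowth := by
  induction q using MvPolynomial.induction_on with
  | C a =>
    have : polyFun (C a : MvPolynomial τ ℂ) = fun _ => a := funext fun t => by simp
    exact this ▸ Function.HasTemperateGrowth.const a
  | add p q hp hq =>
    have : polyFun (p + q) = polyFun p + polyFun q := funext fun t => by simp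
    exact this ▸ hp.add hq
  | mul_X p j hp =>
    have h1 : (fun t : τ → ℝ => (t j : ℂ)).HasTemperateGrowth :=
      (Complex.ofRealCLM.comp
        (ContinuousLinearMap.proj (R := ℝ) (φ := fun _ : τ => ℝ) j)).hasTemperateGrowth
    have : polyFun (p * X j) = polyFun p * fun t : τ → ℝ => (t j : ℂ) := funext fun t => by simp
    exact this ▸ hp.mul h1

/-- Multiplication of Schwartz functions by a polynomial. -/
def polyMul (q : MvPolynomial τ ℂ) (g : 𝓢(τ → ℝ, ℂ)) : 𝓢(τ → ℝ, ℂ) :=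
  SchwartzMap.smulLeftCLM ℂ (polyFun q) g

@[simp]
lemma polyMul_apply (q : MvPolynomial τ ℂ) (g : 𝓢(τ → ℝ, ℂ)) (t : τ → ℝ) :
    polyMul q g t = polyFun q t * g t := by
  rw [polyMul, SchwartzMap.smulLeftCLM_apply_apply (hasTemperateGrowth_polyFun q), smul_eq_mul]

lemma hasLineDerivAt_schwartz (g : 𝓢(τ → ℝ, ℂ)) (t v : τ → ℝ) :
    HasDerivAt (fun x : ℝ => g (t + x • v)) ((∂_{v} g) t) 0 := by
  rw [SchwartzMap.lineDerivOp_apply]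
  exact ((g.differentiableAt (x := t)).lineDifferentiableAt (v := v)).hasLineDerivAt

lemma lineDerivOp_polyMul [DecidableEq τ] (q : MvPolynomial τ ℂ) (g : 𝓢(τ → ℝ, ℂ)) (i : τ) :
    ∂_{(Pi.single i 1 : τ → ℝ)} (polyMul q g) =
      polyMul (pderiv i q) g + polyMul q (∂_{(Pi.single i 1 : τ → ℝ)} g) := by
  ext t
  have h1 := hasLineDerivAt_schwartz (polyMul q g) t (Pi.single i 1)
  have h2 := (hasLineDerivAt_polyFun q t i).mul (hasLineDerivAt_schwartz g t (Pi.single i 1))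
  have := h1.unique (h2.congr_of_eventuallyEq (by filter_upwards with x; simp))
  simpa using this

end SchwartzPolynomial

section ZetaIntegral

open scoped SchwartzMap LineDeriv

lemma norm_ofReal_cpow_le {x : ℝ} (hx : 0 ≤ x) {z : ℂ} (hz : 0 < z.re) {n : ℕ} (hn : z.re ≤ n) :
    ‖(x : ℂ) ^ z‖ ≤ (1 + x) ^ n := by
  rw [Complex.norm_cpow_eq_rpow_re_of_nonneg hx hz.ne', ← Real.rpow_natCast]
  calc x ^ z.re ≤ (1 + x) ^ z.re := by gcongr; linarith
    _ ≤ (1 + x) ^ (n : ℝ) := by gcongr; linarith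

lemma norm_log_mul_ofReal_cpow_le {x δ : ℝ} (hx : 0 ≤ x) (hδ : 0 < δ) {z : ℂ} (hz : δ < z.re)
    {n : ℕ} (hn : z.re ≤ n) :
    ‖(Real.log x : ℂ) * (x : ℂ) ^ z‖ ≤ (1 / δ + 1) * (1 + x) ^ (n + 1) := by
  have hδ' : 0 < 1 / δ := by positivity
  rw [norm_mul, Complex.norm_cpow_eq_rpow_re_of_nonneg hx (hδ.trans hz).ne', Complex.norm_real,
    Real.norm_eq_abs]
  rcases hx.eq_or_lt with rfl | hx
  · simp; positivity
  rcases le_total x 1 with h1 | h1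
  · have h2 := (Real.abs_log_mul_self_rpow_lt x δ hx h1 hδ).le
    rw [abs_mul, abs_of_pos (Real.rpow_pos_of_pos hx _)] at h2
    calc |Real.log x| * x ^ z.re ≤ |Real.log x| * x ^ δ := by
          gcongr _ * ?_
          exact Real.rpow_le_rpow_of_exponent_ge hx h1 hz.le
      _ ≤ 1 / δ + 1 := by linarith
      _ ≤ (1 / δ + 1) * (1 + x) ^ (n + 1) :=
          le_mul_of_one_le_right (by positivity) (one_le_pow₀ (by linarith))
  · have h2 : x ^ z.re ≤ (1 + x) ^ n := by
      have := norm_ofReal_cpow_le hx.le (hδ.trans hz) hn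
      rwa [Complex.norm_cpow_eq_rpow_re_of_nonneg hx.le (hδ.trans hz).ne'] at this
    have h3 : |Real.log x| ≤ 1 + x := by
      rw [abs_of_nonneg (Real.log_nonneg h1)]
      linarith [Real.log_le_sub_one_of_pos hx]
    calc |Real.log x| * x ^ z.re ≤ (1 + x) * (1 + x) ^ n := by gcongr
      _ = 1 * (1 + x) ^ (n + 1) := by ring
      _ ≤ _ := by gcongr; linarith

lemma hasDerivAt_ofReal_cpow_of_one_lt_re {x : ℝ} (hx : 0 ≤ x) {z : ℂ} (hz : 1 < z.re) :
    HasDerivAt (fun y : ℝ => (y : ℂ) ^ z) (z * (x : ℂ) ^ (z - 1)) x := by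
  rcases hx.eq_or_lt with rfl | hx
  · have hz1 : z - 1 ≠ 0 := fun h => by
      have := congrArg Complex.re h
      simp at this; linarith
    have hz0 : z ≠ 0 := fun h => by simp [h] at hz; linarith
    rw [hasDerivAt_iff_isLittleO]
    simp only [Complex.ofReal_zero, Complex.zero_cpow hz1, Complex.zero_cpow hz0, mul_zero,
      smul_zero, sub_zero]
    have h1 : (fun y : ℝ => (y : ℂ) ^ z) =O[nhds 0] fun y : ℝ => |y| ^ z.re := by
      refine Asymptotics.IsBigO.of_bound (Real.exp (Real.pi * |z.im|)) (Filter.Eventually.of_forall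
        fun y => ?_)
      refine (Complex.norm_cpow_le _ _).trans ?_
      rw [Complex.norm_real, Real.norm_eq_abs, Real.norm_eq_abs, div_eq_mul_inv, ← Real.exp_neg,
        mul_comm, abs_of_nonneg (a := |y| ^ z.re) (by positivity)]
      gcongr
      refine (neg_le_abs _).trans ?_
      rw [abs_mul]
      gcongr
      exact Complex.abs_arg_le_pi _
    refine h1.trans_isLittleO ?_
    have h2 : (fun y : ℝ => |y| ^ z.re) = fun y : ℝ => |y| ^ (z.re - 1) * |y| := by
      ext y
      rcases eq_or_ne y 0 with rfl | hy
      · simp [Real.zero_rpow (show z.re ≠ 0 by linarith)]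
      · rw [Real.rpow_sub_one (abs_ne_zero.2 hy), div_mul_cancel₀ _ (abs_ne_zero.2 hy)]
    rw [h2]
    have h3 : (fun y : ℝ => |y| ^ (z.re - 1)) =o[nhds 0] fun _ : ℝ => (1 : ℝ) := by
      rw [Asymptotics.isLittleO_one_iff]
      have : Continuous fun y : ℝ => |y| ^ (z.re - 1) :=
        continuous_abs.rpow_const fun _ => Or.inr (by linarith)
      simpa [Real.zero_rpow (show z.re - 1 ≠ 0 by linarith)] using this.tendsto 0
    simpa using h3.mul_isBigO (Asymptotics.isBigO_refl (fun y : ℝ => |y|) _).of_abs_right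
  · have := (hasDerivAt_id (x : ℂ)).cpow_const (c := z) (Or.inl (by simpa using hx))
    simpa using this.comp_ofReal

variable {τ : Type*} [Fintype τ]

/-- The integral of `g P ^ z`. -/
def zetaInt (P : MvPolynomial τ ℝ) (g : 𝓢(τ → ℝ, ℂ)) (z : ℂ) : ℂ :=
  ∫ t, g t * ((eval t P : ℝ) : ℂ) ^ z

variable {P : MvPolynomial τ ℝ} (hP : ∀ t, 0 ≤ eval t P) (g : 𝓢(τ → ℝ, ℂ))

lemma measurable_eval_cpow (P : MvPolynomial τ ℝ) (z : ℂ) :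
    Measurable fun t : τ → ℝ => ((eval t P : ℝ) : ℂ) ^ z :=
  (Complex.measurable_ofReal.comp (continuous_eval P).measurable).pow_const z

include hP

lemma integrable_norm_mul_one_add_pow (n : ℕ) :
    Integrable fun t => ‖g t‖ * ((1 + eval t P) ^ n) := by
  refine ((polyMul (map Complex.ofRealHom ((1 + P) ^ n)) g).integrable (μ := volume)).norm.congr
    (Filter.Eventually.of_forall fun t => ?_)
  have := hP t
  dsimp only
  rw [polyMul_apply, polyFun_map_ofReal, norm_mul, Complex.norm_real, Real.norm_eq_abs, map_pow,
    map_add, map_one, abs_of_nonneg (by positivity), mul_comm]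

lemma integrable_mul_cpow {z : ℂ} (hz : 0 < z.re) :
    Integrable fun t => g t * ((eval t P : ℝ) : ℂ) ^ z := by
  obtain ⟨n, hn⟩ := exists_nat_ge z.re
  refine (integrable_norm_mul_one_add_pow hP g n).mono'
    (g.continuous.aestronglyMeasurable.mul (measurable_eval_cpow P z).aestronglyMeasurable)
    (Filter.Eventually.of_forall fun t => ?_)
  rw [norm_mul]
  gcongr
  exact norm_ofReal_cpow_le (hP t) hz hn

lemma differentiableAt_zetaInt {z : ℂ} (hz : 0 < z.re) :
    DifferentiableAt ℂ (zetaInt P g) z := by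
  obtain ⟨n, hn⟩ := exists_nat_ge (2 * z.re)
  have hmem : ∀ w ∈ Metric.ball z (z.re / 2), z.re / 2 < w.re ∧ w.re ≤ n := fun w hw => by
    have := (Complex.abs_re_le_norm (w - z)).trans_lt (mem_ball_iff_norm.1 hw)
    rw [Complex.sub_re, abs_lt] at this
    constructor <;> linarith
  refine (hasDerivAt_integral_of_dominated_loc_of_deriv_le
    (F := fun w t => g t * ((eval t P : ℝ) : ℂ) ^ w)
    (F' := fun w t => g t * ((Real.log (eval t P) : ℂ) * ((eval t P : ℝ) : ℂ) ^ w))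
    (bound := fun t => ‖g t‖ * (1 + eval t P) ^ (n + 1) * (1 / (z.re / 2) + 1))
    (Metric.ball_mem_nhds z (half_pos hz)) ?_ (integrable_mul_cpow hP g hz) ?_ ?_
    ((integrable_norm_mul_one_add_pow hP g (n + 1)).mul_const _) ?_).2.differentiableAt
  · exact Filter.Eventually.of_forall fun w =>
      g.continuous.aestronglyMeasurable.mul (measurable_eval_cpow P w).aestronglyMeasurable
  · refine g.continuous.aestronglyMeasurable.mul (Measurable.aestronglyMeasurable ?_)
    exact (Complex.measurable_ofReal.comp
      (Real.measurable_log.comp (continuous_eval P).measurable)).mul (measurable_eval_cpow P z)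
  · refine Filter.Eventually.of_forall fun t w hw => ?_
    rw [norm_mul, mul_assoc]
    gcongr
    rw [mul_comm ((1 + eval t P) ^ (n + 1))]
    exact norm_log_mul_ofReal_cpow_le (hP t) (half_pos hz) (hmem w hw).1 (hmem w hw).2
  · refine Filter.Eventually.of_forall fun t w hw => HasDerivAt.const_mul _ ?_
    have hw0 : w ≠ 0 := fun h => by
      have := (hmem w hw).1
      simp [h] at this
      linarith
    have := (hasDerivAt_id w).const_cpow (c := ((eval t P : ℝ) : ℂ)) (Or.inr hw0)
    simpa [mul_comm, Complex.ofReal_log (hP t)] using this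

lemma zetaInt_add (g h : 𝓢(τ → ℝ, ℂ)) {z : ℂ} (hz : 0 < z.re) :
    zetaInt P (g + h) z = zetaInt P g z + zetaInt P h z := by
  rw [zetaInt, zetaInt, zetaInt,
    ← integral_add (integrable_mul_cpow hP g hz) (integrable_mul_cpow hP h hz)]
  simp [add_mul]

omit hP in
lemma zetaInt_smul (c : ℂ) (g : 𝓢(τ → ℝ, ℂ)) (z : ℂ) :
    zetaInt P (c • g) z = c * zetaInt P g z := by
  simp [zetaInt, ← integral_const_mul, mul_assoc]

omit hP in
lemma zetaInt_polyMul_pow (g : 𝓢(τ → ℝ, ℂ)) {z : ℂ} (hz : 0 < z.re) (n : ℕ) :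
    zetaInt P (polyMul (map Complex.ofRealHom P ^ n) g) z = zetaInt P g (z + n) := by
  refine integral_congr_ae (Filter.Eventually.of_forall fun t => ?_)
  dsimp only
  rw [polyMul_apply, ← map_pow, polyFun_map_ofReal, map_pow, Complex.ofReal_pow]
  rcases eq_or_ne (eval t P) 0 with h | h
  · have hz0 : z ≠ 0 := fun h => by simp [h] at hz
    have hzn : z + n ≠ 0 := fun h => by
      have := congrArg Complex.re h
      simp at this
      have : (0 : ℝ) ≤ n := n.cast_nonneg
      linarith
    simp [h, hz0, hzn]
  · rw [Complex.cpow_add _ _ (by exact_mod_cast h), Complex.cpow_natCast]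
    ring

lemma zetaInt_lineDerivOp [DecidableEq τ] (g : 𝓢(τ → ℝ, ℂ)) (i : τ) {z : ℂ} (hz : 1 < z.re) :
    zetaInt P (∂_{(Pi.single i 1 : τ → ℝ)} g) z =
      -(z * zetaInt P (polyMul (map Complex.ofRealHom (pderiv i P)) g) (z - 1)) := by
  have hz0 : 0 < z.re := by linarith
  have hz1 : 0 < (z - 1).re := by simpa using hz
  have hd : ∀ t, HasLineDerivAt ℝ (fun t => ((eval t P : ℝ) : ℂ) ^ z)
      (z * ((eval t P : ℝ) : ℂ) ^ (z - 1) * polyFun (map Complex.ofRealHom (pderiv i P)) t) t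
      (Pi.single i 1 : τ → ℝ) := fun t => by
    have h0 := hasLineDerivAt_polyFun (map Complex.ofRealHom P) t i
    rw [pderiv_map] at h0
    simp only [polyFun_map_ofReal] at h0
    have h1 : HasDerivAt (fun x : ℝ => eval (t + x • Pi.single i 1) P) (eval t (pderiv i P)) 0 := by
      exact (Complex.reCLM.hasFDerivAt.comp_hasDerivAt 0 h0).congr_deriv (by simp)
    have h2 := HasDerivAt.scomp (x := (0 : ℝ)) (g₁ := fun y : ℝ => (y : ℂ) ^ z)
      (hasDerivAt_ofReal_cpow_of_one_lt_re (hP _) hz) h1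
    refine h2.congr_deriv ?_
    simp [polyFun_map_ofReal, mul_comm]
  have h2 : ∀ t, g t * (z * ((eval t P : ℝ) : ℂ) ^ (z - 1) *
      polyFun (map Complex.ofRealHom (pderiv i P)) t) =
      z * (polyMul (map Complex.ofRealHom (pderiv i P)) g t * ((eval t P : ℝ) : ℂ) ^ (z - 1)) :=
    fun t => by rw [polyMul_apply]; ring
  have := integral_bilinear_hasLineDerivAt_right_eq_neg_left_of_integrable
    (μ := volume) (f := g) (g := fun t => ((eval t P : ℝ) : ℂ) ^ z)
    (v := (Pi.single i 1 : τ → ℝ)) (B := ContinuousLinearMap.mul ℝ ℂ)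
    (f' := fun t => (∂_{(Pi.single i 1 : τ → ℝ)} g : 𝓢(τ → ℝ, ℂ)) t)
    (g' := fun t => z * ((eval t P : ℝ) : ℂ) ^ (z - 1) *
      polyFun (map Complex.ofRealHom (pderiv i P)) t)
    (integrable_mul_cpow hP _ hz0)
    (by
      simp only [ContinuousLinearMap.mul_apply', h2]
      exact (integrable_mul_cpow hP _ hz1).const_mul z)
    (integrable_mul_cpow hP _ hz0)
    (fun t _ => hasLineDerivAt_schwartz g t _) fun t _ => hd t
  simp only [ContinuousLinearMap.mul_apply', h2, integral_const_mul] at this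
  rw [zetaInt, zetaInt, this, neg_neg]

end ZetaIntegral

section Continuation

/-- The function `φ`, restricted to some right half-plane, extends to a meromorphic function on
the half-plane of real part larger than `r`. -/
def ExtendsMeromorphically (r : ℝ) (φ : ℂ → ℂ) : Prop :=
  ∃ F : ℂ → ℂ, MeromorphicOn F {s | r < s.re} ∧ ∃ R : ℝ, ∀ s : ℂ, R < s.re → F s = φ s

namespace ExtendsMeromorphically

variable {r : ℝ} {φ ψ : ℂ → ℂ}

lemma congr (h : ExtendsMeromorphically r φ) (R : ℝ) (hR : ∀ s : ℂ, R < s.re → φ s = ψ s) :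
    ExtendsMeromorphically r ψ := by
  obtain ⟨F, hF, R', h⟩ := h
  exact ⟨F, hF, max R R', fun s hs =>
    (h s ((le_max_right _ _).trans_lt hs)).trans (hR s ((le_max_left _ _).trans_lt hs))⟩

lemma zero : ExtendsMeromorphically r fun _ => 0 :=
  ⟨fun _ => 0, fun _ _ => MeromorphicAt.const 0 _, 0, fun _ _ => rfl⟩

lemma add (hφ : ExtendsMeromorphically r φ) (hψ : ExtendsMeromorphically r ψ) :
    ExtendsMeromorphically r fun s => φ s + ψ s := by
  obtain ⟨F, hF, R, h⟩ := hφ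
  obtain ⟨G, hG, R', h'⟩ := hψ
  exact ⟨F + G, hF.add hG, max R R', fun s hs => by
    rw [Pi.add_apply, h s ((le_max_left _ _).trans_lt hs), h' s ((le_max_right _ _).trans_lt hs)]⟩

lemma _root_.meromorphicAt_polynomial_eval (b : Polynomial ℂ) (s : ℂ) :
    MeromorphicAt (fun s => b.eval s) s :=
  (b.differentiable.analyticAt s).meromorphicAt

lemma eval_mul (hφ : ExtendsMeromorphically r φ) (b : Polynomial ℂ) :
    ExtendsMeromorphically r fun s => b.eval s * φ s := by
  obtain ⟨F, hF, R, h⟩ := hφ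
  exact ⟨fun s => b.eval s * F s,
    fun s hs => (meromorphicAt_polynomial_eval b s).mul (hF s hs), R, fun s hs => by
      dsimp only; rw [h s hs]⟩

lemma of_eval_mul {b : Polynomial ℂ} (hb : b ≠ 0)
    (hφ : ExtendsMeromorphically r fun s => b.eval s * φ s) : ExtendsMeromorphically r φ := by
  obtain ⟨F, hF, R, h⟩ := hφ
  obtain ⟨R', hR'⟩ := (b.roots.toFinset.image Complex.re).bddAbove
  refine ⟨fun s => (b.eval s)⁻¹ * F s,
    fun s hs => (meromorphicAt_polynomial_eval b s).inv.mul (hF s hs), max R R', fun s hs => ?_⟩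
  have hs0 : b.eval s ≠ 0 := fun h0 => by
    have : s.re ≤ R' := hR' (Finset.mem_coe.2 (Finset.mem_image_of_mem _ (by simp [hb, h0])))
    linarith [le_max_right R R']
  dsimp only
  rw [h s ((le_max_left _ _).trans_lt hs), inv_mul_cancel_left₀ hs0]

lemma comp_add (hφ : ExtendsMeromorphically r φ) (c : ℝ) :
    ExtendsMeromorphically (r - c) fun s => φ (s + c) := by
  obtain ⟨F, hF, R, h⟩ := hφ
  refine ⟨fun s => F (s + c), fun s hs => ?_, R - c, fun s hs => h _ ?_⟩
  · refine (hF (s + c) ?_).comp_analyticAt (g := fun s => s + (c : ℂ)) (by fun_prop)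
    simp at hs ⊢
    linarith
  · simp
    linarith

end ExtendsMeromorphically

end Continuation

section SchwartzPolynomial

open scoped SchwartzMap LineDeriv

variable {τ : Type*} [Fintype τ]

lemma polyMul_zero (g : 𝓢(τ → ℝ, ℂ)) : polyMul 0 g = 0 := by
  ext t; simp [polyFun]

lemma polyMul_add (p q : MvPolynomial τ ℂ) (g : 𝓢(τ → ℝ, ℂ)) :
    polyMul (p + q) g = polyMul p g + polyMul q g := by
  ext t; simp [add_mul]

lemma polyMul_mul (p q : MvPolynomial τ ℂ) (g : 𝓢(τ → ℝ, ℂ)) :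
    polyMul (p * q) g = polyMul p (polyMul q g) := by
  ext t; simp [mul_assoc]

lemma polyMul_C (c : ℂ) (g : 𝓢(τ → ℝ, ℂ)) : polyMul (C c) g = c • g := by
  ext t; simp

/-- The polynomial `p s`, for a polynomial `p` whose coefficients depend polynomially on `s`. -/
def specialize (s : ℂ) : MvPolynomial τ (Polynomial ℂ) →+* MvPolynomial τ ℂ :=
  map (Polynomial.evalRingHom s)

/-- A real polynomial as a polynomial with coefficients constant in `s`. -/
def constPoly (P : MvPolynomial τ ℝ) : MvPolynomial τ (Polynomial ℂ) :=
  map (Polynomial.C.comp Complex.ofRealHom) P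

omit [Fintype τ] in
@[simp] lemma specialize_constPoly (P : MvPolynomial τ ℝ) (s : ℂ) :
    specialize s (constPoly P) = map Complex.ofRealHom P := by
  rw [specialize, constPoly, map_map]
  congr 2
  ext x
  simp

omit [Fintype τ] in
@[simp] lemma specialize_C (b : Polynomial ℂ) (s : ℂ) :
    specialize s (C b : MvPolynomial τ (Polynomial ℂ)) = C (b.eval s) := by
  simp [specialize]

omit [Fintype τ] in
@[simp] lemma specialize_X (i : τ) (s : ℂ) :
    specialize s (X i : MvPolynomial τ (Polynomial ℂ)) = X i := by
  simp [specialize]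

omit [Fintype τ] in
@[simp] lemma specialize_pderiv (p : MvPolynomial τ (Polynomial ℂ)) (i : τ) (s : ℂ) :
    specialize s (pderiv i p) = pderiv i (specialize s p) := by
  simp [specialize, pderiv_map]

/-- All integrals of `g p(s) P ^ (s - k)` with `g` Schwartz extend meromorphically. -/
def ZetaExtends (P : MvPolynomial τ ℝ) (r : ℝ) (p : MvPolynomial τ (Polynomial ℂ)) (k : ℕ) : Prop :=
  ∀ g : 𝓢(τ → ℝ, ℂ),
    ExtendsMeromorphically r fun s => zetaInt P (polyMul (specialize s p) g) (s - k)

namespace ZetaExtends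

variable {P : MvPolynomial τ ℝ} {r : ℝ} {p q : MvPolynomial τ (Polynomial ℂ)} {k : ℕ}

lemma zero : ZetaExtends P r (0 : MvPolynomial τ (Polynomial ℂ)) k := fun g => by
  simpa [polyMul_zero, zetaInt] using ExtendsMeromorphically.zero

lemma C_mul (hp : ZetaExtends P r p k) (b : Polynomial ℂ) : ZetaExtends P r (C b * p) k :=
  fun g => by simpa [polyMul_mul, polyMul_C, zetaInt_smul] using (hp g).eval_mul b

lemma X_mul (hp : ZetaExtends P r p k) (i : τ) : ZetaExtends P r (X i * p) k := fun g => by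
  have := hp (polyMul (X i) g)
  simp only [← polyMul_mul] at this
  simpa [mul_comm] using this

lemma constPoly_pow_mul (hp : ZetaExtends P r p k) (n : ℕ) :
    ZetaExtends P r (constPoly P ^ n * p) (n + k) := fun g => by
  refine (hp g).congr (n + k) fun s hs => ?_
  rw [map_mul, map_pow, specialize_constPoly, polyMul_mul, zetaInt_polyMul_pow]
  · push_cast; ring_nf
  · simp; linarith

variable (hP : ∀ t, 0 ≤ eval t P)
include hP

lemma add (hp : ZetaExtends P r p k) (hq : ZetaExtends P r q k) : ZetaExtends P r (p + q) k :=
  fun g => ((hp g).add (hq g)).congr k fun s hs => by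
    rw [map_add, polyMul_add, zetaInt_add hP]
    simpa using hs

lemma twisted (hp : ZetaExtends P r p k) (i : τ) : ZetaExtends P r
    (constPoly P * pderiv i p + C (Polynomial.X - (k : Polynomial ℂ)) * pderiv i (constPoly P) * p)
    (k + 1) := fun g => by
  classical
  refine ((hp (∂_{(Pi.single i 1 : τ → ℝ)} g)).eval_mul (-1)).congr (k + 1) fun s hs => ?_
  have h1 : 1 < (s - k).re := by simp; linarith
  have h2 : s - (k + 1 : ℕ) = s - k - 1 := by push_cast; ring
  have h3 : 0 < (s - k - 1).re := by simpa using h1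
  have key := zetaInt_lineDerivOp hP (polyMul (specialize s p) g) i h1
  have h4 := zetaInt_polyMul_pow (P := P) (polyMul (specialize s (pderiv i p)) g) h3 1
  rw [lineDerivOp_polyMul, zetaInt_add hP _ _ (by linarith)] at key
  rw [pow_one, Nat.cast_one, sub_add_cancel] at h4
  rw [h2, map_add, polyMul_add, zetaInt_add hP _ _ h3, map_mul, specialize_constPoly, polyMul_mul,
    h4, map_mul, map_mul, specialize_C, mul_assoc, polyMul_mul, polyMul_C, zetaInt_smul,
    polyMul_mul, specialize_pderiv, specialize_pderiv, specialize_constPoly, pderiv_map]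
  simp only [Polynomial.eval_sub, Polynomial.eval_X, Polynomial.eval_natCast, Polynomial.eval_neg,
    Polynomial.eval_one]
  linear_combination -key

end ZetaExtends

end SchwartzPolynomial

section Good

open scoped SchwartzMap

variable {τ : Type*}

/-- The field of rational functions in the exponent `s`. -/
abbrev ExponentField : Type := FractionRing (Polynomial ℂ)

/-- Polynomials in `s` and `t` as rational functions of `t` over the field of rational functions
in `s`. -/
def toRational : MvPolynomial τ (Polynomial ℂ) →+*
    FractionRing (MvPolynomial τ ExponentField) :=
  (algebraMap (MvPolynomial τ ExponentField) _).comp (map (algebraMap (Polynomial ℂ) ExponentField))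

lemma toRational_injective : Function.Injective (toRational (τ := τ)) :=
  (IsFractionRing.injective (MvPolynomial τ ExponentField) _).comp
    (map_injective _ (IsFractionRing.injective (Polynomial ℂ) ExponentField))

lemma toRational_C_mul (b : Polynomial ℂ) (p : MvPolynomial τ (Polynomial ℂ)) :
    toRational (C b * p) = algebraMap (Polynomial ℂ) ExponentField b • toRational p := by
  rw [map_mul, Algebra.smul_def, IsScalarTower.algebraMap_apply ExponentField
    (MvPolynomial τ ExponentField)]
  simp [toRational]

lemma constPoly_ne_zero {P : MvPolynomial τ ℝ} (hP : P ≠ 0) : constPoly P ≠ 0 := by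
  refine (map_ne_zero_iff _ (map_injective _ ?_)).2 hP
  exact Polynomial.C_injective.comp Complex.ofReal_injective

variable [Fintype τ]

/-- The rational functions `w` such that, up to a denominator, all integrals of `g w(s) P ^ s`
with `g` Schwartz extend meromorphically. -/
def goodSubmodule {P : MvPolynomial τ ℝ} (hP : ∀ t, 0 ≤ eval t P) (hP0 : P ≠ 0) (r : ℝ) :
    Submodule ExponentField (FractionRing (MvPolynomial τ ExponentField)) where
  carrier := {w | ∃ b : Polynomial ℂ, b ≠ 0 ∧ ∃ k p, ZetaExtends P r p k ∧
    algebraMap _ ExponentField b • w = toRational p / toRational (constPoly P) ^ k}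
  zero_mem' := ⟨1, one_ne_zero, 0, 0, .zero, by simp⟩
  add_mem' := by
    rintro v w ⟨b, hb, k, p, hp, hv⟩ ⟨c, hc, m, q, hq, hw⟩
    have h0 : toRational (constPoly P) ≠ 0 :=
      (map_ne_zero_iff _ toRational_injective).2 (constPoly_ne_zero hP0)
    refine ⟨b * c, mul_ne_zero hb hc, m + k, C c * (constPoly P ^ m * p) +
      C b * (constPoly P ^ k * q), ((hp.constPoly_pow_mul m).C_mul c).add hP
        (add_comm k m ▸ (hq.constPoly_pow_mul k).C_mul b), ?_⟩
    rw [map_add, toRational_C_mul, toRational_C_mul, map_mul, map_mul, map_mul, map_pow, map_pow,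
      smul_add, mul_smul, mul_smul, hw, smul_comm, hv, add_div, smul_div_assoc, smul_div_assoc]
    congr 2
    · field_simp
      ring
    · field_simp
      ring
  smul_mem' := by
    rintro a w ⟨b, hb, k, p, hp, hw⟩
    obtain ⟨c, d, hd, rfl⟩ := IsFractionRing.div_surjective (A := Polynomial ℂ) a
    have hd0 : algebraMap _ ExponentField d ≠ 0 := by simpa using nonZeroDivisors.ne_zero hd
    refine ⟨b * d, mul_ne_zero hb (nonZeroDivisors.ne_zero hd), k, C c * p, hp.C_mul c, ?_⟩
    rw [toRational_C_mul, smul_div_assoc, ← hw, smul_smul, smul_smul, map_mul]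
    congr 1
    field_simp

lemma mulVar_mem_goodSubmodule {P : MvPolynomial τ ℝ} (hP : ∀ t, 0 ≤ eval t P) (hP0 : P ≠ 0)
    {r : ℝ} (i : τ) {w : FractionRing (MvPolynomial τ ExponentField)}
    (hw : w ∈ goodSubmodule hP hP0 r) : mulVar i w ∈ goodSubmodule hP hP0 r := by
  obtain ⟨b, hb, k, p, hp, hw⟩ := hw
  refine ⟨b, hb, k, X i * p, hp.X_mul i, ?_⟩
  rw [← map_smul, hw, mulVar_apply, map_mul, mul_div_assoc]
  simp [toRational]

lemma twistedPderiv_mem_goodSubmodule {P : MvPolynomial τ ℝ} (hP : ∀ t, 0 ≤ eval t P)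
    (hP0 : P ≠ 0) {r : ℝ} (i : τ) {w : FractionRing (MvPolynomial τ ExponentField)}
    (hw : w ∈ goodSubmodule hP hP0 r) :
    twistedPderiv (algebraMap (Polynomial ℂ) ExponentField Polynomial.X)
      (map (algebraMap (Polynomial ℂ) ExponentField) (constPoly P)) i w ∈
        goodSubmodule hP hP0 r := by
  obtain ⟨b, hb, k, p, hp, hw⟩ := hw
  refine ⟨b, hb, k + 1, _, hp.twisted hP i, ?_⟩
  have h0 : map (algebraMap (Polynomial ℂ) ExponentField) (constPoly P) ≠ 0 :=
    (map_ne_zero_iff _ (map_injective _ (IsFractionRing.injective _ _))).2 (constPoly_ne_zero hP0)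
  rw [← map_smul, hw]
  refine (twistedPderiv_div _ h0 i _ k).trans ?_
  simp [toRational, pderiv_map]

/-- If all integrals of `g P ^ s` extend to real part larger than `r`, then they extend to real
part larger than `r - 1`. -/
lemma extendsMeromorphically_zetaInt_sub_one {P : MvPolynomial τ ℝ} (hP : ∀ t, 0 ≤ eval t P)
    (hP0 : P ≠ 0) {r : ℝ} (h : ∀ g : 𝓢(τ → ℝ, ℂ), ExtendsMeromorphically r (zetaInt P g))
    (g : 𝓢(τ → ℝ, ℂ)) : ExtendsMeromorphically (r - 1) (zetaInt P g) := by
  have h0 : map (algebraMap (Polynomial ℂ) ExponentField) (constPoly P) ≠ 0 :=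
    (map_ne_zero_iff _ (map_injective _ (IsFractionRing.injective _ _))).2 (constPoly_ne_zero hP0)
  obtain ⟨a, ha⟩ := exists_pow_mem_orbitSpan_pow_succ
    (algebraMap (Polynomial ℂ) ExponentField Polynomial.X) h0
  have hmem := orbitSpan_le (S := goodSubmodule hP hP0 (r - (a + 1 : ℕ))) ?_ ?_ ha
  · obtain ⟨b, hb, k, p, hp, hw⟩ := hmem
    have hp' : C b * constPoly P ^ (k + a) = p := by
      apply toRational_injective
      have h1 : toRational (constPoly P) ≠ 0 :=
        (map_ne_zero_iff _ toRational_injective).2 (constPoly_ne_zero hP0)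
      rw [toRational_C_mul, map_pow, add_comm, pow_add, ← smul_mul_assoc]
      exact (eq_div_iff (pow_ne_zero _ h1)).1 hw
    subst hp'
    have h2 : ExtendsMeromorphically (r - (a + 1 : ℕ)) fun s => zetaInt P g (s + (a : ℝ)) := by
      refine .of_eval_mul hb ((hp g).congr k fun s hs => ?_)
      rw [map_mul, map_pow, specialize_C, specialize_constPoly, polyMul_mul, polyMul_C,
        zetaInt_smul, zetaInt_polyMul_pow _ (by simpa using hs)]
      push_cast
      ring_nf
    convert (h2.comp_add (-a)) using 1
    · push_cast; ring
    · ext s; simp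
  · refine ⟨1, one_ne_zero, 0, constPoly P ^ (a + 1), fun g => ?_, ?_⟩
    · refine ((h g).comp_add (a + 1 : ℕ)).congr 0 fun s hs => ?_
      simp only [map_pow, specialize_constPoly, Nat.cast_zero, sub_zero]
      rw [zetaInt_polyMul_pow _ hs, Complex.ofReal_natCast]
    · simp [toRational]
  · rintro (i | i) w hw
    · exact mulVar_mem_goodSubmodule hP hP0 i hw
    · exact twistedPderiv_mem_goodSubmodule hP hP0 i hw

lemma extendsMeromorphically_zetaInt {P : MvPolynomial τ ℝ} (hP : ∀ t, 0 ≤ eval t P)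
    (hP0 : P ≠ 0) (n : ℕ) (g : 𝓢(τ → ℝ, ℂ)) : ExtendsMeromorphically (-n) (zetaInt P g) := by
  induction n generalizing g with
  | zero =>
    refine ⟨zetaInt P g, fun s hs => ?_, 0, fun _ _ => rfl⟩
    have hd : DifferentiableOn ℂ (zetaInt P g) {s | 0 < s.re} := fun s hs =>
      (differentiableAt_zetaInt hP g hs).differentiableWithinAt
    refine (hd.analyticAt ?_).meromorphicAt
    exact (isOpen_lt continuous_const Complex.continuous_re).mem_nhds (by simpa using hs)
  | succ n ih =>
    have := extendsMeromorphically_zetaInt_sub_one hP hP0 ih g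
    rwa [show -((n + 1 : ℕ) : ℝ) = -n - 1 by push_cast; ring]

end Good

section Gluing

open Filter Topology

lemma isOpen_re_gt (r : ℝ) : IsOpen {s : ℂ | r < s.re} :=
  isOpen_lt continuous_const Complex.continuous_re

/-- Identity theorem for meromorphic functions on a right half-plane. -/
lemma MeromorphicOn.eventuallyEq_nhdsNE_of_re_gt {r R : ℝ} {F G : ℂ → ℂ}
    (hF : MeromorphicOn F {s | r < s.re}) (hG : MeromorphicOn G {s | r < s.re})
    (h : ∀ s : ℂ, R < s.re → F s = G s) {s : ℂ} (hs : r < s.re) : F =ᶠ[𝓝[≠] s] G := by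
  by_contra hne
  have htop : meromorphicOrderAt (F - G) s ≠ ⊤ := fun h0 => hne <| by
    filter_upwards [meromorphicOrderAt_eq_top_iff.1 h0] with z hz using sub_eq_zero.1 hz
  set y : ℂ := ((max r R + 1 : ℝ) : ℂ)
  have hy : max r R < y.re := by simp [y]
  refine (hF.sub hG).meromorphicOrderAt_ne_top_of_isPreconnected
    (convex_halfSpace_re_gt r).isPreconnected hs (y := y) ((le_max_left _ _).trans_lt hy) htop
    (meromorphicOrderAt_eq_top_iff.2 ?_)
  filter_upwards [nhdsWithin_le_nhds ((isOpen_re_gt R).mem_nhds ((le_max_right _ _).trans_lt hy))]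
    with z hz
  simp [h z hz]

lemma exists_meromorphicOn_univ_of_extendsMeromorphically {φ : ℂ → ℂ}
    (hφ : DifferentiableOn ℂ φ {s | 0 < s.re}) (h : ∀ n : ℕ, ExtendsMeromorphically (-n) φ) :
    ∃ F : ℂ → ℂ, MeromorphicOn F Set.univ ∧ ∀ s : ℂ, 0 < s.re → F s = φ s := by
  choose F hF R hR using h
  have hFF : ∀ (m n : ℕ) {s : ℂ}, -(m : ℝ) < s.re → -(n : ℝ) < s.re → F m =ᶠ[𝓝[≠] s] F n := by
    intro m n s hm hn
    have hle : ∀ k : ℕ, (k = m ∨ k = n) →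
        MeromorphicOn (F k) {s | max (-(m : ℝ)) (-(n : ℝ)) < s.re} := by
      rintro k (rfl | rfl) z hz
      · exact hF _ z (Set.mem_ofPred.2 <| (le_max_left _ _).trans_lt hz)
      · exact hF _ z (Set.mem_ofPred.2 <| (le_max_right _ _).trans_lt hz)
    refine (hle m (.inl rfl)).eventuallyEq_nhdsNE_of_re_gt (hle n (.inr rfl))
      (R := max (R m) (R n)) (fun z hz => ?_) (max_lt hm hn)
    rw [hR m z ((le_max_left _ _).trans_lt hz), hR n z ((le_max_right _ _).trans_lt hz)]
  set N : ℂ → ℕ := fun s => ⌈-s.re⌉₊ + 1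
  have hN : ∀ s, -(N s : ℝ) < s.re := fun s => by
    have := Nat.le_ceil (-s.re)
    push_cast [N]
    linarith
  refine ⟨fun s => toMeromorphicNFAt (F (N s)) s s, fun s _ => ?_, fun s hs => ?_⟩
  · refine MeromorphicAt.congr (meromorphicNFOn_toMeromorphicNFOn (F (N s)) {z | -(N s : ℝ) < z.re}
      (hN s)).meromorphicAt (EventuallyEq.filter_mono ?_ nhdsWithin_le_nhds)
    filter_upwards [(isOpen_re_gt _).mem_nhds (hN s)] with z hz
    rw [toMeromorphicNFOn_eq_toMeromorphicNFAt (hF _) hz]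
    exact (toMeromorphicNFAt_eventuallyEq_nhds_congr (hFF _ _ hz (hN z))).eq_of_nhds
  · have hφ' : ∀ z ∈ {z : ℂ | 0 < z.re}, AnalyticAt ℂ φ z := fun z hz =>
      hφ.analyticAt ((isOpen_re_gt 0).mem_nhds hz)
    have h1 : F (N s) =ᶠ[𝓝[≠] s] φ :=
      MeromorphicOn.eventuallyEq_nhdsNE_of_re_gt (r := 0) (R := R (N s))
        (fun z hz => hF _ z (Set.mem_ofPred.2 <| lt_of_le_of_lt (neg_nonpos.2 (Nat.cast_nonneg _)) hz))
        (fun z hz => (hφ' z hz).meromorphicAt) (hR (N s)) hs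
    dsimp only
    rw [(toMeromorphicNFAt_eventuallyEq_nhds_congr h1).eq_of_nhds,
      toMeromorphicNFAt_eq_self.2 (hφ' s hs).meromorphicNFAt]

end Gluing

section

open scoped SchwartzMap

lemma differentiableOn_zetaInt {τ : Type*} [Fintype τ] {P : MvPolynomial τ ℝ}
    (hP : ∀ t, 0 ≤ eval t P) (g : 𝓢(τ → ℝ, ℂ)) : DifferentiableOn ℂ (zetaInt P g) {s | 0 < s.re} :=
  fun _ hs => (differentiableAt_zetaInt hP g hs).differentiableWithinAt

lemma exists_meromorphicOn_univ_zetaInt {τ : Type*} [Fintype τ] {P : MvPolynomial τ ℝ}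
    (hP : ∀ t, 0 ≤ eval t P) (hP0 : P ≠ 0) (g : 𝓢(τ → ℝ, ℂ)) :
    ∃ F : ℂ → ℂ, MeromorphicOn F Set.univ ∧ ∀ s : ℂ, 0 < s.re → F s = zetaInt P g s :=
  exists_meromorphicOn_univ_of_extendsMeromorphically (differentiableOn_zetaInt hP g)
    fun n => extendsMeromorphically_zetaInt hP hP0 n g

end

section SquareSubstitution

open scoped Real ENNReal

/-- The map `(x, y) ↦ x² + y²` pushes Lebesgue measure on the plane forward to `π` times Lebesgue
measure on the positive half-line. -/
lemma map_sq_add_sq_volume :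
    (volume : Measure (ℝ × ℝ)).map (fun p => p.1 ^ 2 + p.2 ^ 2) =
      ENNReal.ofReal π • (volume : Measure ℝ).restrict (Set.Ioi 0) := by
  have hm : Measurable fun p : ℝ × ℝ => p.1 ^ 2 + p.2 ^ 2 := by fun_prop
  ext s hs
  have hind : Measurable (s.indicator (1 : ℝ → ℝ≥0∞)) := measurable_one.indicator hs
  have himg : (fun r : ℝ => r ^ 2) '' Set.Ioi 0 = Set.Ioi 0 := by
    ext x
    refine ⟨?_, fun hx => ⟨√x, Real.sqrt_pos.2 hx, Real.sq_sqrt (le_of_lt hx)⟩⟩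
    rintro ⟨r, hr, rfl⟩
    exact pow_pos (show 0 < r from hr) 2
  have hcov := lintegral_image_eq_lintegral_abs_deriv_mul (s := Set.Ioi (0 : ℝ))
    (f := fun r => r ^ 2) (f' := fun r => 2 * r) measurableSet_Ioi
    (fun r _ => by simpa using (hasDerivAt_pow 2 r).hasDerivWithinAt)
    (fun x hx y hy h => (sq_eq_sq₀ (le_of_lt hx) (le_of_lt hy)).1 h) (s.indicator 1)
  rw [himg, lintegral_indicator_one hs] at hcov
  have hpolar := lintegral_comp_polarCoord_symm fun p => s.indicator 1 (p.1 ^ 2 + p.2 ^ 2)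
  have hsq : ∀ p : ℝ × ℝ, (polarCoord.symm p).1 ^ 2 + (polarCoord.symm p).2 ^ 2 = p.1 ^ 2 := by
    intro p
    simp only [polarCoord_symm_apply]
    linear_combination p.1 ^ 2 * Real.cos_sq_add_sin_sq p.2
  simp only [hsq, polarCoord_target, smul_eq_mul] at hpolar
  have hprod : ∫⁻ p in Set.Ioi (0 : ℝ) ×ˢ Set.Ioo (-π) π,
      ENNReal.ofReal p.1 * s.indicator 1 (p.1 ^ 2) =
      (∫⁻ r in Set.Ioi (0 : ℝ), ENNReal.ofReal r * s.indicator 1 (r ^ 2)) *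
        ENNReal.ofReal (2 * π) := by
    have hmeas : Measurable fun r : ℝ => ENNReal.ofReal r * s.indicator (1 : ℝ → ℝ≥0∞) (r ^ 2) := by
      fun_prop
    rw [Measure.volume_eq_prod, ← Measure.prod_restrict, lintegral_prod _ (by fun_prop)]
    simp only [lintegral_const, Measure.restrict_apply_univ, Real.volume_Ioo]
    rw [lintegral_mul_const _ hmeas]
    ring_nf
  rw [Measure.map_apply hm hs, Measure.smul_apply, hcov, ← lintegral_indicator_one (hm hs)]
  refine hpolar.symm.trans (hprod.trans ?_)
  rw [smul_eq_mul, ENNReal.ofReal_mul two_pos.le, ← mul_assoc, mul_comm]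
  congr 1
  rw [← lintegral_mul_const _ (by fun_prop)]
  refine setLIntegral_congr_fun measurableSet_Ioi fun r hr => ?_
  have hr : 0 < r := hr
  rw [abs_of_pos (by positivity), ENNReal.ofReal_mul two_pos.le]
  ring

variable {ι : Type*} [Fintype ι]

/-- The substitution `tᵢ = xᵢ² + yᵢ²`, whose image is the closed orthant. -/
def sumSq (y : ι ⊕ ι → ℝ) (i : ι) : ℝ := y (Sum.inl i) ^ 2 + y (Sum.inr i) ^ 2

omit [Fintype ι] in
lemma measurable_sumSq : Measurable (sumSq : (ι ⊕ ι → ℝ) → ι → ℝ) := by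
  unfold sumSq
  fun_prop

lemma map_sumSq_volume : (volume : Measure (ι ⊕ ι → ℝ)).map sumSq =
    ENNReal.ofReal π ^ Fintype.card ι •
      (volume : Measure (ι → ℝ)).restrict {t | ∀ i, 0 < t i} := by
  have h1 := (volume_measurePreserving_arrowProdEquivProdArrow ℝ ℝ ι).symm.comp
    (volume_measurePreserving_sumPiEquivProdPi fun _ : ι ⊕ ι => ℝ)
  have h2 : (sumSq : (ι ⊕ ι → ℝ) → ι → ℝ) = (fun p i => (p i).1 ^ 2 + (p i).2 ^ 2) ∘
      ((MeasurableEquiv.arrowProdEquivProdArrow ℝ ℝ ι).symm ∘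
        MeasurableEquiv.sumPiEquivProdPi fun _ : ι ⊕ ι => ℝ) := rfl
  have hset : {t : ι → ℝ | ∀ i, 0 < t i} = Set.univ.pi fun _ => Set.Ioi 0 := by
    ext; simp
  have hfin : SigmaFinite (ENNReal.ofReal π • (volume : Measure ℝ).restrict (Set.Ioi 0)) :=
    SMul.sigmaFinite (Real.toNNReal π)
  have : SigmaFinite ((volume : Measure (ℝ × ℝ)).map fun p => p.1 ^ 2 + p.2 ^ 2) := by
    rwa [map_sq_add_sq_volume]
  have h3 := Measure.pi_map_pi (ι := ι) (μ := fun _ => (volume : Measure (ℝ × ℝ)))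
    (f := fun _ p => p.1 ^ 2 + p.2 ^ 2) (fun _ => by fun_prop)
  rw [h2, ← Measure.map_map (by fun_prop) h1.measurable, h1.map_eq, volume_pi,
    h3, map_sq_add_sq_volume, hset, volume_pi,
    Measure.restrict_pi_pi]
  refine Measure.pi_eq fun s hs => ?_
  simp [Finset.prod_mul_distrib, Measure.pi_pi]

end SquareSubstitution

section Orthant

open scoped Real SchwartzMap

variable {ι : Type*} [Fintype ι]

lemma integrable_comp_sumSq_iff {f : (ι → ℝ) → ℂ} (hf : Measurable f) :
    Integrable (f ∘ sumSq) ↔ IntegrableOn f {t | ∀ i, 0 < t i} := by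
  rw [← integrable_map_measure hf.aestronglyMeasurable measurable_sumSq.aemeasurable,
    map_sumSq_volume, integrable_smul_measure (by simp [Real.pi_pos]) (by simp), IntegrableOn]

lemma integral_comp_sumSq {f : (ι → ℝ) → ℂ} (hf : Measurable f) :
    ∫ y, f (sumSq y) = (π : ℂ) ^ Fintype.card ι * ∫ t in {t | ∀ i, 0 < t i}, f t := by
  rw [← integral_map measurable_sumSq.aemeasurable hf.aestronglyMeasurable, map_sumSq_volume,
    integral_smul_measure, ENNReal.toReal_pow, ENNReal.toReal_ofReal Real.pi_pos.le,
    Complex.real_smul, Complex.ofReal_pow]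

lemma hasTemperateGrowth_sumSq : (sumSq : (ι ⊕ ι → ℝ) → ι → ℝ).HasTemperateGrowth := by
  classical
  have hproj : ∀ j : ι ⊕ ι, (fun y : ι ⊕ ι → ℝ => y j).HasTemperateGrowth := fun j =>
    (ContinuousLinearMap.proj (R := ℝ) (φ := fun _ : ι ⊕ ι => ℝ) j).hasTemperateGrowth
  have h : (sumSq : (ι ⊕ ι → ℝ) → ι → ℝ) = fun y => ∑ i,
      ((fun y : ι ⊕ ι → ℝ => y (Sum.inl i)) ^ 2 + (fun y : ι ⊕ ι → ℝ => y (Sum.inr i)) ^ 2) y •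
        (Pi.single i 1 : ι → ℝ) := by
    ext y j
    simp [sumSq, Finset.sum_apply, Pi.single_apply]
  rw [h]
  exact Function.HasTemperateGrowth.sum fun i _ =>
    (((hproj _).pow 2).add ((hproj _).pow 2)).smul (.const _)

lemma norm_le_one_add_norm_sumSq (y : ι ⊕ ι → ℝ) : ‖y‖ ≤ 1 * (1 + ‖sumSq y‖) ^ 1 := by
  rw [one_mul, pow_one]
  refine (pi_norm_le_iff_of_nonneg (by positivity)).2 fun j => ?_
  obtain ⟨i, hi⟩ : ∃ i, y j ^ 2 ≤ sumSq y i := by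
    rcases j with i | i
    · exact ⟨i, le_add_of_nonneg_right (sq_nonneg _)⟩
    · exact ⟨i, le_add_of_nonneg_left (sq_nonneg _)⟩
  have h1 := (le_abs_self _).trans (norm_le_pi_norm (sumSq y) i)
  rw [Real.norm_eq_abs]
  nlinarith [sq_abs (y j), sq_nonneg (|y j| - 1)]

/-- The complexified pullback of a real Schwartz function under `sumSq`. -/
def compSumSq (g : 𝓢(ι → ℝ, ℝ)) : 𝓢(ι ⊕ ι → ℝ, ℂ) :=
  SchwartzMap.postcompCLM Complex.ofRealCLM (SchwartzMap.compCLM ℝ hasTemperateGrowth_sumSq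
    ⟨1, 1, norm_le_one_add_norm_sumSq⟩ g)

lemma compSumSq_apply (g : 𝓢(ι → ℝ, ℝ)) (y : ι ⊕ ι → ℝ) :
    compSumSq g y = (g (sumSq y) : ℂ) := rfl

/-- The pullback of a polynomial under `sumSq`. -/
def bindSumSq (Q : MvPolynomial ι ℝ) : MvPolynomial (ι ⊕ ι) ℝ :=
  bind₁ (fun i => X (Sum.inl i) ^ 2 + X (Sum.inr i) ^ 2) Q

omit [Fintype ι] in
lemma eval_bindSumSq (Q : MvPolynomial ι ℝ) (y : ι ⊕ ι → ℝ) :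
    eval y (bindSumSq Q) = eval (sumSq y) Q := by
  rw [bindSumSq, ← coe_aeval_eq_eval, RingHom.coe_coe, aeval_bind₁, ← coe_aeval_eq_eval]
  simp
  rfl

omit [Fintype ι] in
lemma eval_nonneg_of_nonneg {Q : MvPolynomial ι ℝ}
    (hQ : ∀ t : ι → ℝ, (∀ i, 0 < t i) → 0 < eval t Q) {t : ι → ℝ} (ht : ∀ i, 0 ≤ t i) :
    0 ≤ eval t Q := by
  have hc : Continuous fun ε : ℝ => eval (fun i => t i + ε) Q :=
    (continuous_eval Q).comp (by fun_prop)
  have h := (hc.tendsto 0).mono_left (nhdsWithin_le_nhds (s := Set.Ioi 0))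
  simp only [add_zero] at h
  refine ge_of_tendsto h (Filter.eventually_of_mem self_mem_nhdsWithin fun ε hε => ?_)
  exact (hQ _ fun i => add_pos_of_nonneg_of_pos (ht i) hε).le

omit [Fintype ι] in
lemma eval_bindSumSq_nonneg {Q : MvPolynomial ι ℝ}
    (hQ : ∀ t : ι → ℝ, (∀ i, 0 < t i) → 0 < eval t Q) (y : ι ⊕ ι → ℝ) :
    0 ≤ eval y (bindSumSq Q) := by
  rw [eval_bindSumSq]
  exact eval_nonneg_of_nonneg hQ fun i => add_nonneg (sq_nonneg _) (sq_nonneg _)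

omit [Fintype ι] in
lemma bindSumSq_ne_zero {Q : MvPolynomial ι ℝ}
    (hQ : ∀ t : ι → ℝ, (∀ i, 0 < t i) → 0 < eval t Q) : bindSumSq Q ≠ 0 := fun h => by
  have h1 := eval_bindSumSq Q 1
  rw [h, map_zero] at h1
  exact (hQ _ fun i => by simp [sumSq]).ne h1

lemma measurable_mul_eval_cpow (Q : MvPolynomial ι ℝ) (g : 𝓢(ι → ℝ, ℝ)) (z : ℂ) :
    Measurable fun t => (g t : ℂ) * ((eval t Q : ℝ) : ℂ) ^ z :=
  (Complex.measurable_ofReal.comp g.continuous.measurable).mul (measurable_eval_cpow Q z)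

lemma integrableOn_mul_eval_cpow {Q : MvPolynomial ι ℝ}
    (hQ : ∀ t : ι → ℝ, (∀ i, 0 < t i) → 0 < eval t Q) (g : 𝓢(ι → ℝ, ℝ)) {z : ℂ} (hz : 0 < z.re) :
    IntegrableOn (fun t => (g t : ℂ) * ((eval t Q : ℝ) : ℂ) ^ z) {t | ∀ i, 0 < t i} := by
  refine (integrable_comp_sumSq_iff (measurable_mul_eval_cpow Q g z)).1 ?_
  refine (integrable_mul_cpow (eval_bindSumSq_nonneg hQ) (compSumSq g) hz).congr
    (Filter.Eventually.of_forall fun y => ?_)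
  simp [compSumSq_apply, eval_bindSumSq]

lemma setIntegral_orthant_eq_zetaInt (Q : MvPolynomial ι ℝ) (g : 𝓢(ι → ℝ, ℝ)) (z : ℂ) :
    ∫ t in {t | ∀ i, 0 < t i}, (g t : ℂ) * ((eval t Q : ℝ) : ℂ) ^ z =
      ((π : ℂ) ^ Fintype.card ι)⁻¹ * zetaInt (bindSumSq Q) (compSumSq g) z := by
  have hπ : (π : ℂ) ^ Fintype.card ι ≠ 0 := pow_ne_zero _ (by exact_mod_cast Real.pi_ne_zero)
  rw [eq_inv_mul_iff_mul_eq₀ hπ, ← integral_comp_sumSq (measurable_mul_eval_cpow Q g z), zetaInt]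
  simp [compSumSq_apply, eval_bindSumSq]

end Orthant

/-- Bernstein continuation of `I(D) = ∫_{(0,∞)ˡ} g(t) Q(t)^{−D/2} dt`.
Let `l ≥ 1`, `Q` a real polynomial in `l` variables positive on the open orthant, and `g`
a Schwartz function.  Then (i) for `Re D < 0` the integrand is integrable on the orthant,
(ii) `I` is holomorphic on `{Re D < 0}`, and (iii) there is a function meromorphic on all
of `ℂ` agreeing with `I` on that half-plane. -/
theorem bernstein_meromorphic_continuation (l : ℕ) (hl : 1 ≤ l)
    (Q : MvPolynomial (Fin l) ℝ)
    (hQ : ∀ t : Fin l → ℝ, (∀ i, 0 < t i) → 0 < MvPolynomial.eval t Q)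
    (g : SchwartzMap (Fin l → ℝ) ℝ) :
    (∀ D : ℂ, D.re < 0 →
      IntegrableOn
        (fun t : Fin l → ℝ =>
          ((g t : ℝ) : ℂ) * ((MvPolynomial.eval t Q : ℝ) : ℂ) ^ (-D / 2))
        {t : Fin l → ℝ | ∀ i, 0 < t i} volume) ∧
    DifferentiableOn ℂ
      (fun D : ℂ => ∫ t in {t : Fin l → ℝ | ∀ i, 0 < t i},
        ((g t : ℝ) : ℂ) * ((MvPolynomial.eval t Q : ℝ) : ℂ) ^ (-D / 2))
      {D : ℂ | D.re < 0} ∧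
    ∃ F : ℂ → ℂ, MeromorphicOn F Set.univ ∧
      ∀ D : ℂ, D.re < 0 →
        F D = ∫ t in {t : Fin l → ℝ | ∀ i, 0 < t i},
          ((g t : ℝ) : ℂ) * ((MvPolynomial.eval t Q : ℝ) : ℂ) ^ (-D / 2) := by
  have hre : ∀ D : ℂ, D.re < 0 → 0 < (-D / 2).re := fun D hD => by
    rw [show (-D / 2).re = -D.re / 2 by simp]
    linarith
  have hP := eval_bindSumSq_nonneg hQ
  refine ⟨fun D hD => integrableOn_mul_eval_cpow hQ g (hre D hD), ?_, ?_⟩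
  · simp only [setIntegral_orthant_eq_zetaInt]
    exact ((differentiableOn_zetaInt hP (compSumSq g)).comp (by fun_prop) hre).const_mul _
  · obtain ⟨F, hF, hFeq⟩ :=
      exists_meromorphicOn_univ_zetaInt hP (bindSumSq_ne_zero hQ) (compSumSq g)
    refine ⟨fun D => ((Real.pi : ℂ) ^ Fintype.card (Fin l))⁻¹ * F (-D / 2), fun D _ => ?_,
      fun D hD => ?_⟩
    · exact (MeromorphicAt.const _ _).mul
        ((hF _ (Set.mem_univ _)).comp_analyticAt (g := fun D => -D / 2) (by fun_prop))
    · dsimp only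
      rw [hFeq _ (hre D hD), setIntegral_orthant_eq_zetaInt]

end
end
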